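/- Let U ⊆ ℝⁿ be an open connected neighbourhood of a point a ∈ ℝⁿ and let f : U → ℝ be a real-analytic function, not identically zero, with f(a) = 0 and ∇f(a) = 0. Let P ∈ ℝ[x₁,…,xₙ,y] be an irreducible polynomial such that P(x, f(x)) = 0 for all x ∈ U, let d = deg P, and assume that ∂P/∂y(x, f(x)) ≠ 0 for all x ∈ U. Then there exist constants C > 0 and ε > 0 such that |∇f(x)| ≥ C·|f(x)|^(1 − 1/R(n,d)) for every x ∈ U with |x − a| < ε and |f(x)| < ε. -/

import Mathlib

section BivariatePolynomials

open Polynomial Filter Topology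

theorem Polynomial.exists_hasStrictFDerivAt_evalEval (Q : ℝ[X][X]) :
    ∃ Qt : ℝ[X][X], ∀ p : ℝ × ℝ, HasStrictFDerivAt (fun p : ℝ × ℝ => Q.evalEval p.1 p.2)
      (Qt.evalEval p.1 p.2 • ContinuousLinearMap.fst ℝ ℝ ℝ +
        (derivative Q).evalEval p.1 p.2 • ContinuousLinearMap.snd ℝ ℝ ℝ) p := by
  induction Q using Polynomial.induction_on' with
  | add P Q hP hQ =>
    obtain ⟨Pt, hP⟩ := hP
    obtain ⟨Qt, hQ⟩ := hQ
    refine ⟨Pt + Qt, fun p => ?_⟩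
    simp only [evalEval_add, derivative_add]
    refine ((hP p).add (hQ p)).congr_fderiv ?_
    module
  | monomial k c =>
    refine ⟨monomial k (derivative c), fun p => ?_⟩
    have h1 : HasStrictFDerivAt (fun p : ℝ × ℝ => c.eval p.1)
        ((derivative c).eval p.1 • ContinuousLinearMap.fst ℝ ℝ ℝ) p :=
      (c.hasStrictDerivAt p.1).comp_hasStrictFDerivAt p hasStrictFDerivAt_fst
    have h2 : HasStrictFDerivAt (fun p : ℝ × ℝ => p.2 ^ k)
        ((k * p.2 ^ (k - 1) : ℝ) • ContinuousLinearMap.snd ℝ ℝ ℝ) p :=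
      (hasStrictDerivAt_pow k p.2).comp_hasStrictFDerivAt p hasStrictFDerivAt_snd
    have h := h1.mul h2
    simp only [evalEval, eval_monomial, derivative_monomial, eval_mul, eval_pow, eval_C,
      eval_natCast]
    refine h.congr_fderiv ?_
    module

theorem Polynomial.continuous_evalEval (Q : ℝ[X][X]) :
    Continuous fun p : ℝ × ℝ => Q.evalEval p.1 p.2 := by
  obtain ⟨_, h⟩ := Q.exists_hasStrictFDerivAt_evalEval
  exact continuous_iff_continuousAt.2 fun p => (h p).hasFDerivAt.continuousAt

/-- Extract the largest power of the first variable from a bivariate polynomial. -/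
theorem Polynomial.exists_eq_C_X_pow_mul {A : Type*} [CommRing A] [IsDomain A] {Q : A[X][X]}
    (hQ : Q ≠ 0) :
    ∃ (e : ℕ) (Q₁ : A[X][X]), Q = C X ^ e * Q₁ ∧ Q₁.map (evalRingHom 0) ≠ 0 ∧
      Q₁.natDegree = Q.natDegree := by
  have key : ∀ m : ℕ, ∀ Q : A[X][X], Q ≠ 0 → Q.leadingCoeff.natDegree ≤ m →
      ∃ (e : ℕ) (Q₁ : A[X][X]), Q = C X ^ e * Q₁ ∧ Q₁.map (evalRingHom 0) ≠ 0 ∧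
        Q₁.natDegree = Q.natDegree := by
    intro m
    induction m with
    | zero =>
      intro Q hQ hm
      refine ⟨0, Q, by simp, fun h => hQ ?_, rfl⟩
      rw [← leadingCoeff_eq_zero]
      have h1 := congrArg (fun p => p.coeff Q.natDegree) h
      rw [eq_C_of_natDegree_le_zero hm]
      simpa [coeff_zero_eq_eval_zero] using h1
    | succ m ih =>
      intro Q hQ hm
      by_cases h : Q.map (evalRingHom 0) = 0
      · have hd : C X ∣ Q := by
          rw [C_dvd_iff_dvd_coeff]
          intro i
          rw [X_dvd_iff, coeff_zero_eq_eval_zero]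
          simpa using congrArg (fun p => p.coeff i) h
        obtain ⟨Q', rfl⟩ := hd
        have hQ' : Q' ≠ 0 := right_ne_zero_of_mul hQ
        have hdeg : (C X * Q').natDegree = Q'.natDegree := natDegree_C_mul X_ne_zero
        obtain ⟨e, Q₁, h1, h2, h3⟩ := ih Q' hQ' (by
          rw [leadingCoeff_mul, leadingCoeff_C, natDegree_X_mul (leadingCoeff_ne_zero.2 hQ')] at hm
          omega)
        exact ⟨e + 1, Q₁, by rw [h1, pow_succ']; ring_nf, h2, h3.trans hdeg.symm⟩
      · exact ⟨0, Q, by simp, h, rfl⟩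
  exact key _ Q hQ le_rfl

/-- Real roots of a bivariate polynomial near the origin: either small with a Hölder bound, or
bounded away from zero. -/
theorem Polynomial.exists_root_dichotomy {W : ℝ[X][X]} (hW : W ≠ 0) {D : ℕ} (hD : 1 ≤ D)
    (hWD : W.natDegree ≤ D) :
    ∃ C > 0, ∃ c > 0, ∃ δ > 0, ∀ t ∈ Set.Ioo 0 δ, ∀ z, W.evalEval t z = 0 →
      |z| ≤ C * t ^ (1 / (D : ℝ)) ∨ c ≤ |z| := by
  obtain ⟨e, W₁, rfl, hW₀, hdeg⟩ := exists_eq_C_X_pow_mul hW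
  set W₀ := W₁.map (evalRingHom 0) with hW₀def
  have hdvd : Polynomial.C X ∣ W₁ - W₀.map Polynomial.C := by
    rw [C_dvd_iff_dvd_coeff]
    intro i
    rw [X_dvd_iff, coeff_zero_eq_eval_zero]
    simp [hW₀def]
  obtain ⟨G, hG⟩ := hdvd
  have hW₁ : ∀ t z, W₁.evalEval t z = W₀.eval z + t * G.evalEval t z := by
    intro t z
    have := congrArg (evalEval t z) hG
    simp only [evalEval_sub, evalEval_map_C, evalEval_mul, evalEval_C, eval_X] at this
    linarith
  obtain ⟨g, hg, hg0⟩ := exists_eq_pow_rootMultiplicity_mul_and_not_dvd W₀ hW₀ 0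
  set k := rootMultiplicity 0 W₀
  have hk : k ≤ D := by
    have h1 : k ≤ W₀.natDegree := by
      have h2 : k = W₀.roots.count 0 := (count_roots W₀).symm
      exact h2.le.trans ((Multiset.count_le_card 0 _).trans (card_roots' W₀))
    exact h1.trans (natDegree_map_le.trans (hdeg.le.trans hWD))
  rw [dvd_iff_isRoot, IsRoot.def] at hg0
  have hg0' : 0 < |g.eval 0| := abs_pos.2 hg0
  set K := |G.evalEval 0 0| + 1
  have hK : 0 < K := by positivity
  have e1 : ∀ᶠ z in 𝓝 (0 : ℝ), |g.eval 0| / 2 < |g.eval z| :=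
    (g.continuous.abs.tendsto 0).eventually_const_lt (by linarith)
  have e2 : ∀ᶠ p in 𝓝 ((0 : ℝ), (0 : ℝ)), |G.evalEval p.1 p.2| < K :=
    (G.continuous_evalEval.abs.tendsto (0, 0)).eventually_lt_const (by simp [K])
  obtain ⟨c₁, hc₁, e1⟩ := Metric.eventually_nhds_iff.1 e1
  obtain ⟨c₂, hc₂, e2⟩ := Metric.eventually_nhds_iff.1 e2
  set K' := 2 * K / |g.eval 0|
  have hK' : 0 < K' := by positivity
  refine ⟨K' ^ (1 / (D : ℝ)), by positivity, min 1 (min c₁ c₂), by positivity, c₂, hc₂, ?_⟩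
  rintro t ⟨ht0, ht⟩ z hz
  rw [or_iff_not_imp_right, not_le]
  intro hzc
  simp only [lt_min_iff] at hzc
  have h0 : W₁.evalEval t z = 0 := by
    simpa [evalEval_mul, evalEval_pow, evalEval_C, ht0.ne'] using hz
  rw [hW₁, hg, eval_mul] at h0
  simp only [map_zero, sub_zero, eval_pow, eval_X] at h0
  have h1 : |g.eval 0| / 2 < |g.eval z| := e1 (by simpa using hzc.2.1)
  have h2 : |G.evalEval t z| < K :=
    e2 (y := (t, z)) (by simp [Prod.dist_eq, abs_of_pos ht0, ht, hzc.2.2])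
  have h3 : |z| ^ k * |g.eval z| = t * |G.evalEval t z| := by
    rw [← abs_pow, ← abs_mul, ← abs_of_pos ht0, ← abs_mul, abs_of_pos ht0,
      eq_neg_of_add_eq_zero_left h0, abs_neg]
  have h4 : |z| ^ D ≤ K' * t := by
    have h5 : |z| ^ k * (|g.eval 0| / 2) ≤ t * K := by
      calc _ ≤ |z| ^ k * |g.eval z| := by gcongr
        _ = _ := h3
        _ ≤ _ := by gcongr
    calc |z| ^ D ≤ |z| ^ k := pow_le_pow_of_le_one (abs_nonneg z) hzc.1.le hk
      _ ≤ K' * t := by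
        simp only [K']
        rw [div_mul_eq_mul_div, le_div_iff₀ hg0']
        linarith
  rw [← Real.mul_rpow hK'.le ht0.le]
  calc |z| = (|z| ^ D) ^ (1 / (D : ℝ)) := by
        rw [one_div, Real.pow_rpow_inv_natCast (abs_nonneg z) (by omega)]
    _ ≤ _ := by gcongr

theorem Polynomial.map_sum_mul_pow_mul_pow {A F : Type*} [CommRing A] [Field F]
    (ψ : A[X] →+* F) (W V G : A[X]) (hG : ψ G ≠ 0) :
    ψ (∑ i ∈ Finset.range (W.natDegree + 1), C (W.coeff i) * V ^ i * G ^ (W.natDegree - i)) =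
      ψ G ^ W.natDegree * W.eval₂ (ψ.comp C) (ψ V / ψ G) := by
  rw [eval₂_eq_sum_range, map_sum, Finset.mul_sum]
  refine Finset.sum_congr rfl fun i hi => ?_
  rw [Finset.mem_range, Nat.lt_succ_iff] at hi
  obtain ⟨j, hj⟩ := Nat.exists_eq_add_of_le hi
  simp only [map_mul, map_pow, RingHom.comp_apply, div_pow, hj, Nat.add_sub_cancel_left, pow_add]
  field_simp

/-- A quotient of two polynomial functions restricted to an irreducible plane curve satisfies a
polynomial equation whose degree is at most that of the curve. -/
theorem Polynomial.exists_relation_of_irreducible {Q : ℝ[X][X]} (hQ : Irreducible Q)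
    (hdeg : Q.natDegree ≠ 0) (V G : ℝ[X][X]) (hG : ¬ Q ∣ G) :
    ∃ W : ℝ[X][X], W ≠ 0 ∧ W.natDegree ≤ Q.natDegree ∧ ∀ t u, Q.evalEval t u = 0 →
      G.evalEval t u ≠ 0 → W.evalEval t (V.evalEval t u / G.evalEval t u) = 0 := by
  let K := FractionRing ℝ[X]
  have hprim : Q.IsPrimitive := hQ.isPrimitive hdeg
  set q : K[X] := Q.map (algebraMap ℝ[X] K) with hq
  have hqirr : Irreducible q := hprim.irreducible_iff_irreducible_map_fraction_map.1 hQ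
  have : Fact (Irreducible q) := ⟨hqirr⟩
  let φ : ℝ[X][X] →+* AdjoinRoot q := (AdjoinRoot.mk q).comp (mapRingHom (algebraMap ℝ[X] K))
  have hφ : ∀ P, φ P = 0 ↔ Q ∣ P := by
    intro P
    simp only [φ, RingHom.comp_apply, AdjoinRoot.mk_eq_zero, coe_mapRingHom]
    exact ⟨fun h => hprim.dvd_of_fraction_map_dvd_fraction_map h, fun h => map_dvd _ h⟩
  have : Module.Finite K (AdjoinRoot q) := (AdjoinRoot.powerBasis hqirr.ne_zero).finite
  set v := φ V / φ G
  have hint : IsIntegral K v := IsIntegral.of_finite K v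
  have hminpoly : (minpoly K v).natDegree ≤ Q.natDegree := by
    refine (minpoly.natDegree_le v).trans ?_
    rw [(AdjoinRoot.powerBasis hqirr.ne_zero).finrank, AdjoinRoot.powerBasis_dim]
    exact natDegree_map_le
  set W := IsLocalization.integerNormalization (nonZeroDivisors ℝ[X]) (minpoly K v) with hWdef
  have hW : W ≠ 0 := by
    rw [hWdef, Ne, IsLocalization.integerNormalization_eq_zero_iff le_rfl]
    exact minpoly.ne_zero hint
  obtain ⟨b, -, hb⟩ := IsLocalization.integerNormalization_spec (nonZeroDivisors ℝ[X]) (minpoly K v)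
  rw [← hWdef] at hb
  have hv : W.eval₂ (φ.comp C) v = 0 := by
    have h1 : φ.comp C = (algebraMap K (AdjoinRoot q)).comp (algebraMap ℝ[X] K) := by
      ext <;> simp [φ, AdjoinRoot.algebraMap_eq]
    rw [h1, ← eval₂_map, hb, ← aeval_def, algebra_compatible_smul K b, map_smul, minpoly.aeval,
      smul_zero]
  refine ⟨W, hW, ?_, fun t u hu hGu => ?_⟩
  · exact (natDegree_le_natDegree
      (degree_mono (IsLocalization.integerNormalization_support _ _))).trans hminpoly
  · have hZ := map_sum_mul_pow_mul_pow φ W V G ((hφ G).not.2 hG)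
    rw [hv, mul_zero, hφ] at hZ
    have hZ' := evalEval_dvd t u hZ
    rw [hu, zero_dvd_iff] at hZ'
    have h2 := map_sum_mul_pow_mul_pow (evalEvalRingHom t u) W V G hGu
    rw [coe_evalEvalRingHom, hZ', eq_comm, mul_eq_zero] at h2
    have h3 := h2.resolve_left (pow_ne_zero _ hGu)
    have h4 : (evalEvalRingHom t u).comp C = evalRingHom t := by ext <;> simp
    rw [h4] at h3
    rw [← coe_evalEvalRingHom, evalEvalRingHom_eq]
    exact h3

theorem Polynomial.exists_derivative_ne_zero_of_irreducible {Q : ℝ[X][X]} (hQ : Irreducible Q)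
    (hdeg : Q.natDegree ≠ 0) :
    ∃ h : ℝ[X], h ≠ 0 ∧ ∀ t u, Q.evalEval t u = 0 → h.eval t ≠ 0 →
      (derivative Q).evalEval t u ≠ 0 := by
  let K := FractionRing ℝ[X]
  have hprim : Q.IsPrimitive := hQ.isPrimitive hdeg
  have hqirr : Irreducible (Q.map (algebraMap ℝ[X] K)) :=
    hprim.irreducible_iff_irreducible_map_fraction_map.1 hQ
  have hcop : IsCoprime (Q.map (algebraMap ℝ[X] K)) ((derivative Q).map (algebraMap ℝ[X] K)) := by
    rw [← derivative_map]
    exact hqirr.separable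
  have hinj := IsFractionRing.injective ℝ[X] K
  refine ⟨resultant Q (derivative Q), fun h => ?_, fun t u hu ht h0 => ht ?_⟩
  · have h1 := congrArg (algebraMap ℝ[X] K) h
    refine resultant_ne_zero _ _ hcop ?_
    rw [natDegree_map_eq_of_injective hinj, natDegree_map_eq_of_injective hinj, resultant_map_map,
      h, map_zero]
  · obtain ⟨p, q, -, -, h⟩ := exists_mul_add_mul_eq_C_resultant Q (derivative Q) le_rfl le_rfl
      (Or.inl hdeg)
    have := congrArg (evalEval t u) h
    simpa [evalEval_add, evalEval_mul, hu, h0, evalEval_C] using this.symm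
theorem HasStrictFDerivAt.exists_local_branch {F : ℝ × ℝ → ℝ} {α β t u : ℝ}
    (hF : HasStrictFDerivAt F
      (α • ContinuousLinearMap.fst ℝ ℝ ℝ + β • ContinuousLinearMap.snd ℝ ℝ ℝ) (t, u))
    (hβ : β ≠ 0) (h0 : F (t, u) = 0) :
    ∃ g : ℝ → ℝ, g t = u ∧ HasDerivAt g (-(α / β)) t ∧ ∀ᶠ s in 𝓝 t, F (s, g s) = 0 := by
  have hinv : ((α • ContinuousLinearMap.fst ℝ ℝ ℝ + β • ContinuousLinearMap.snd ℝ ℝ ℝ) ∘L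
      .inr ℝ ℝ ℝ).IsInvertible := by
    refine ⟨ContinuousLinearEquiv.unitsEquivAut ℝ (Units.mk0 β hβ), ?_⟩
    ext
    simp
  set g := hF.implicitFunctionOfProdDomain hinv
  have hgt : g t = u :=
    (hF.eventually_apply_eq_iff_implicitFunctionOfProdDomain hinv).self_of_nhds.mp rfl
  have hev : ∀ᶠ s in 𝓝 t, F (s, g s) = 0 := by
    simpa [h0] using hF.eventually_apply_implicitFunctionOfProdDomain hinv
  have hg := (hF.hasStrictFDerivAt_implicitFunctionOfProdDomain hinv).hasFDerivAt.hasDerivAt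
  refine ⟨g, hgt, ?_, hev⟩
  set γ := (-(((α • ContinuousLinearMap.fst ℝ ℝ ℝ + β • ContinuousLinearMap.snd ℝ ℝ ℝ) ∘L
      .inr ℝ ℝ ℝ).inverse) ∘L ((α • ContinuousLinearMap.fst ℝ ℝ ℝ +
      β • ContinuousLinearMap.snd ℝ ℝ ℝ) ∘L .inl ℝ ℝ ℝ)) (1 : ℝ)
  have h1 : HasDerivAt (fun s => F (s, g s)) (α + β * γ) t := by
    have hF' := hF.hasFDerivAt
    rw [← hgt] at hF'
    have := hF'.comp_hasDerivAt t ((hasDerivAt_id t).prodMk hg)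
    refine this.congr_deriv ?_
    simp [γ]
  have h2 : HasDerivAt (fun s => F (s, g s)) 0 t :=
    (hasDerivAt_const t 0).congr_of_eventuallyEq hev
  have h3 := h1.unique h2
  have h4 : -(α / β) = γ := by
    field_simp
    linarith
  rw [h4]
  exact hg

/-- The derivative of a bounded branch of an irreducible plane curve, near `t = 0`. -/
theorem Polynomial.exists_branch_derivative_bound {Q Qt : ℝ[X][X]} (hQ : Irreducible Q)
    (hdeg : Q.natDegree ≠ 0) {D : ℕ} (hD : Q.natDegree ≤ D)
    (hQt : ∀ p : ℝ × ℝ, HasStrictFDerivAt (fun p : ℝ × ℝ => Q.evalEval p.1 p.2)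
      (Qt.evalEval p.1 p.2 • ContinuousLinearMap.fst ℝ ℝ ℝ +
        (derivative Q).evalEval p.1 p.2 • ContinuousLinearMap.snd ℝ ℝ ℝ) p) (B : ℝ) :
    ∃ C > 0, ∃ δ > 0, ∀ t ∈ Set.Ioo 0 δ, ∀ u, |u| ≤ B → Q.evalEval t u = 0 →
      (derivative Q).evalEval t u ≠ 0 ∧
        t * |Qt.evalEval t u / (derivative Q).evalEval t u| ≤ C * t ^ (1 / (D : ℝ)) := by
  have hD1 : 1 ≤ D := by omega
  have hdvd : ¬ Q ∣ derivative Q := fun h => by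
    have h1 : derivative Q ≠ 0 := fun h0 => hdeg (derivative_eq_zero.1 h0)
    have h2 := natDegree_le_of_dvd h h1
    have h3 := natDegree_derivative_lt hdeg
    omega
  obtain ⟨W, hW0, hWdeg, hW⟩ :=
    exists_relation_of_irreducible hQ hdeg (C X * Qt) (derivative Q) hdvd
  obtain ⟨h, hh0, hh⟩ := exists_derivative_ne_zero_of_irreducible hQ hdeg
  obtain ⟨C, hC, c, hc, δ₁, hδ₁, hdich⟩ := exists_root_dichotomy hW0 hD1 (hWdeg.trans hD)
  have hQ0 : Q.map (evalRingHom 0) ≠ 0 := by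
    intro h0
    refine not_isUnit_X ((hQ.isPrimitive hdeg) X ?_)
    rw [C_dvd_iff_dvd_coeff]
    intro i
    rw [X_dvd_iff, coeff_zero_eq_eval_zero]
    simpa using congrArg (fun p => p.coeff i) h0
  obtain ⟨B', hBB', hB'1, hB'2⟩ : ∃ B', max B 0 < B' ∧ Q.evalEval 0 B' ≠ 0 ∧
      Q.evalEval 0 (-B') ≠ 0 := by
    have hev : ∀ u, Q.evalEval 0 u = (Q.map (evalRingHom 0)).eval u := fun u => by
      rw [← coe_evalEvalRingHom, evalEvalRingHom_eq, coe_eval₂RingHom, eval_map]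
    set Q₀ := Q.map (evalRingHom 0)
    have hfin : (Q₀.rootSet ℝ ∪ Neg.neg ⁻¹' Q₀.rootSet ℝ).Finite :=
      (Q₀.rootSet_finite ℝ).union ((Q₀.rootSet_finite ℝ).preimage neg_injective.injOn)
    obtain ⟨B', hB', hn⟩ := ((Set.Ioi_infinite (max B 0)).sdiff hfin).nonempty
    simp only [Set.mem_union, Set.mem_preimage, mem_rootSet, not_or, not_and,
      coe_aeval_eq_eval] at hn
    exact ⟨B', hB', by rw [hev]; exact hn.1 hQ0, by rw [hev]; exact hn.2 hQ0⟩
  have hB'0 : 0 < B' := (le_max_right _ _).trans_lt hBB'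
  have e1 : ∀ᶠ t in 𝓝[>] (0 : ℝ), Q.evalEval t B' ≠ 0 ∧ Q.evalEval t (-B') ≠ 0 := by
    refine Eventually.filter_mono nhdsWithin_le_nhds (Eventually.and ?_ ?_)
    · exact ContinuousAt.eventually_ne
        (Q.continuous_evalEval.comp (continuous_id.prodMk continuous_const)).continuousAt hB'1
    · exact ContinuousAt.eventually_ne
        (Q.continuous_evalEval.comp (continuous_id.prodMk continuous_const)).continuousAt hB'2
  have e2 : ∀ᶠ t in 𝓝[>] (0 : ℝ), h.eval t ≠ 0 := by
    have : {t | h.eval t = 0}.Finite := (h.rootSet_finite ℝ).subset fun t ht => by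
      simpa [mem_rootSet, hh0] using ht
    exact (this.eventually_cofinite_notMem).filter_mono
      ((nhdsWithin_mono _ fun _ hx => ne_of_gt hx).trans (nhdsNE_le_cofinite 0))
  have e3 : ∀ᶠ t in 𝓝[>] (0 : ℝ), C * t ^ (1 / (D : ℝ)) < c / 2 := by
    have hcont : Continuous fun t : ℝ => C * t ^ (1 / (D : ℝ)) :=
      continuous_const.mul (Real.continuous_rpow_const (by positivity))
    refine (hcont.tendsto 0).mono_left nhdsWithin_le_nhds |>.eventually_lt_const ?_
    rw [Real.zero_rpow (by positivity)]
    linarith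
  obtain ⟨δ₂, hδ₂, hδ⟩ := mem_nhdsGT_iff_exists_Ioo_subset.1
    (e1.and (e2.and (e3.and (Ioo_mem_nhdsGT hδ₁))))
  simp only [Set.mem_Ioi] at hδ₂
  set v : ℝ × ℝ → ℝ := fun p => p.1 * (Qt.evalEval p.1 p.2 / (derivative Q).evalEval p.1 p.2)
  have hQ' : ∀ t ∈ Set.Ioo 0 δ₂, ∀ u, Q.evalEval t u = 0 → (derivative Q).evalEval t u ≠ 0 :=
    fun t ht u hu => hh t u hu (hδ ht).2.1
  have hv : ∀ t ∈ Set.Ioo 0 δ₂, ∀ u, Q.evalEval t u = 0 →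
      |v (t, u)| ≤ C * t ^ (1 / (D : ℝ)) ∨ c ≤ |v (t, u)| := by
    intro t ht u hu
    refine hdich t (hδ ht).2.2.2 _ ?_
    have := hW t u hu (hQ' t ht u hu)
    simpa [v, evalEval_mul, evalEval_C, mul_div_assoc] using this
  have hvc : ∀ t ∈ Set.Ioo 0 δ₂, ∀ u, Q.evalEval t u = 0 → ContinuousAt v (t, u) := by
    intro t ht u hu
    exact continuousAt_fst.mul (Qt.continuous_evalEval.continuousAt.div
      (derivative Q).continuous_evalEval.continuousAt (hQ' t ht u hu))
  set δ₃ := δ₂ / 2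
  have hδ₃ : 0 < δ₃ := by positivity
  have hδ₃₂ : δ₃ < δ₂ := half_lt_self hδ₂
  refine ⟨C, hC, δ₃ * Real.exp (-(4 * B' / c + 1)), by positivity, fun t₁ ht₁ u₁ hu₁ hroot => ?_⟩
  have hlt : t₁ < δ₃ := ht₁.2.trans_le (mul_le_of_le_one_right hδ₃.le
    (Real.exp_le_one_iff.2 (by have : 0 ≤ 4 * B' / c := by positivity
                               linarith)))
  have ht₁' : t₁ ∈ Set.Ioo 0 δ₂ := ⟨ht₁.1, hlt.trans hδ₃₂⟩
  refine ⟨hQ' t₁ ht₁' u₁ hroot, ?_⟩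
  have habs : t₁ * |Qt.evalEval t₁ u₁ / (derivative Q).evalEval t₁ u₁| = |v (t₁, u₁)| := by
    simp only [v, abs_mul, abs_of_pos ht₁.1]
  rw [habs]
  refine (hv t₁ ht₁' u₁ hroot).resolve_right fun hbad => ?_
  obtain ⟨s, hs1, hs⟩ : ∃ s : ℝ, |s| = 1 ∧ c ≤ -(s * v (t₁, u₁)) := by
    rcases le_total (v (t₁, u₁)) 0 with hneg | hpos
    · exact ⟨1, by simp, by rwa [one_mul, ← abs_of_nonpos hneg]⟩
    · exact ⟨-1, by simp, by rwa [neg_one_mul, neg_neg, ← abs_of_nonneg hpos]⟩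
  set Z : Set ℝ := {t | ∃ u, |u| ≤ B' ∧ Q.evalEval t u = 0 ∧ c ≤ -(s * v (t, u)) ∧
    0 ≤ s * (u - u₁) - c / 2 * Real.log (t / t₁)} with hZ
  have hclosed : IsClosed (Z ∩ Set.Icc t₁ δ₃) := by
    set E₀ : Set (ℝ × ℝ) := (Set.Icc t₁ δ₃ ×ˢ Set.Icc (-B') B') ∩ {p | Q.evalEval p.1 p.2 = 0}
    have hE₀ : IsCompact E₀ := (isCompact_Icc.prod isCompact_Icc).inter_right
      (isClosed_eq Q.continuous_evalEval continuous_const)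
    set φ : ℝ × ℝ → ℝ × ℝ := fun p =>
      (-(s * v p), s * (p.2 - u₁) - c / 2 * Real.log (p.1 / t₁))
    have hφ : ContinuousOn φ E₀ := by
      rintro ⟨t, u⟩ ⟨⟨ht, -⟩, hu⟩
      have ht0 : 0 < t := ht₁.1.trans_le ht.1
      have c1 := hvc t ⟨ht0, ht.2.trans_lt hδ₃₂⟩ u hu
      have c2 : ContinuousAt (fun p : ℝ × ℝ => Real.log (p.1 / t₁)) (t, u) :=
        (continuousAt_fst.div_const t₁).log (div_pos ht0 ht₁.1).ne'
      refine ContinuousAt.continuousWithinAt ?_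
      exact (continuousAt_const.mul c1).neg.prodMk
        ((continuousAt_const.mul (continuousAt_snd.sub continuousAt_const)).sub
          (continuousAt_const.mul c2))
    have hE : IsCompact (E₀ ∩ φ ⁻¹' (Set.Ici c ×ˢ Set.Ici 0)) :=
      hE₀.of_isClosed_subset (hφ.preimage_isClosed_of_isClosed hE₀.isClosed
        (isClosed_Ici.prod isClosed_Ici)) Set.inter_subset_left
    convert (hE.image continuous_fst).isClosed using 1
    ext t
    constructor
    · rintro ⟨⟨u, h1, h2, h3, h4⟩, ht⟩
      exact ⟨(t, u), ⟨⟨⟨ht, abs_le.1 h1⟩, h2⟩, h3, h4⟩, rfl⟩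
    · rintro ⟨⟨t', u⟩, ⟨⟨⟨ht, h1⟩, h2⟩, h3, h4⟩, rfl⟩
      exact ⟨⟨u, abs_le.2 h1, h2, h3, h4⟩, ht⟩
  have hmem : t₁ ∈ Z := ⟨u₁, hu₁.trans ((le_max_left _ _).trans hBB'.le), hroot, hs, by
    simp [div_self ht₁.1.ne']⟩
  have hsub := hclosed.Icc_subset_of_forall_exists_gt hmem (by
    rintro t ⟨⟨u, hu, hQu, hvu, hlog⟩, ht⟩ y hy
    have ht0 : 0 < t := ht₁.1.trans_le ht.1
    have htδ : t ∈ Set.Ioo 0 δ₂ := ⟨ht0, ht.2.trans hδ₃₂⟩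
    obtain ⟨g, hgt, hg, hgQ⟩ := (hQt (t, u)).exists_local_branch (hQ' t htδ u hQu) hQu
    have huB : |u| < B' := by
      refine lt_of_le_of_ne hu fun heq => ?_
      rcases (abs_eq hB'0.le).1 heq with h | h
      · exact (hδ htδ).1.1 (h ▸ hQu)
      · exact (hδ htδ).1.2 (h ▸ hQu)
    have f1 : ∀ᶠ r in 𝓝[>] t, |g r| < B' :=
      (hg.continuousAt.abs.eventually_lt_const (by simpa [hgt] using huB)).filter_mono
        nhdsWithin_le_nhds
    have f2 : ∀ᶠ r in 𝓝[>] t, Q.evalEval r (g r) = 0 := hgQ.filter_mono nhdsWithin_le_nhds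
    have f3 : ∀ᶠ r in 𝓝[>] t, r ∈ Set.Ioo 0 δ₂ :=
      nhdsWithin_le_nhds (Ioo_mem_nhds htδ.1 htδ.2)
    have f4 : ∀ᶠ r in 𝓝[>] t, c / 2 < -(s * v (r, g r)) := by
      have hcomp : ContinuousAt (fun r => v (r, g r)) t :=
        ContinuousAt.comp (g := v) (f := fun r => (r, g r)) (by rw [hgt]; exact hvc t htδ u hQu)
          (continuousAt_id.prodMk hg.continuousAt)
      have := (continuousAt_const.mul hcomp).neg (f := fun r => s * v (r, g r))
      exact (this.eventually_const_lt (by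
        simp only [Pi.neg_apply, hgt]; linarith)).filter_mono nhdsWithin_le_nhds
    have f5 : ∀ᶠ r in 𝓝[>] t, c / 2 / t < slope (fun r => s * g r) t r := by
      have hsg := hasDerivAt_iff_tendsto_slope.1 (hg.const_mul s)
      refine (hsg.mono_left (nhdsWithin_mono _ fun _ hx => ne_of_gt hx)).eventually_const_lt ?_
      rw [div_lt_iff₀ ht0]
      simp only [v] at hvu
      linarith
    obtain ⟨r, hr1, hr2, hr3, hr4, hr5, hr6⟩ :=
      (f1.and (f2.and (f3.and (f4.and (f5.and (Ioc_mem_nhdsGT hy)))))).exists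
    have hr0 := hr3.1
    refine ⟨r, ⟨g r, hr1.le, hr2, ?_, ?_⟩, hr6⟩
    · have habs' : |v (r, g r)| = |-(s * v (r, g r))| := by
        rw [abs_neg, abs_mul s, hs1, one_mul]
      rcases hv r hr3 (g r) hr2 with h | h
      · have := (hδ hr3).2.2.1
        have := le_abs_self (-(s * v (r, g r)))
        simp only at *
        linarith
      · rwa [habs', abs_of_pos (by linarith)] at h
    · rw [slope_def_field, lt_div_iff₀ (sub_pos.2 hr6.1), hgt] at hr5
      have hl1 : Real.log (r / t₁) = Real.log (r / t) + Real.log (t / t₁) := by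
        rw [← Real.log_mul (by positivity) (div_pos ht0 ht₁.1).ne']
        congr 1
        field_simp
      have hl2 := Real.log_le_sub_one_of_pos (div_pos hr0 ht0)
      have hl3 : c / 2 * Real.log (r / t) ≤ c / 2 / t * (r - t) := by
        calc _ ≤ c / 2 * (r / t - 1) := by gcongr
          _ = _ := by field_simp
      rw [hl1]
      linarith)
  obtain ⟨u, hu, -, -, hlog⟩ := hsub ⟨hlt.le, le_rfl⟩
  have hu₁' : |u₁| ≤ B' := hu₁.trans ((le_max_left _ _).trans hBB'.le)
  have hle : s * (u - u₁) ≤ 2 * B' := by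
    calc s * (u - u₁) ≤ |s * (u - u₁)| := le_abs_self _
      _ = |u - u₁| := by rw [abs_mul, hs1, one_mul]
      _ ≤ |u| + |u₁| := abs_sub _ _
      _ ≤ 2 * B' := by linarith
  have hlog2 : 4 * B' / c + 1 < Real.log (δ₃ / t₁) := by
    rw [Real.lt_log_iff_exp_lt (div_pos hδ₃ ht₁.1), lt_div_iff₀ ht₁.1]
    have := mul_lt_mul_of_pos_left ht₁.2 (Real.exp_pos (4 * B' / c + 1))
    rwa [mul_left_comm, ← Real.exp_add, add_neg_cancel, Real.exp_zero, mul_one] at this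
  have : c / 2 * (4 * B' / c + 1) = 2 * B' + c / 2 := by field_simp; ring
  have := mul_lt_mul_of_pos_left hlog2 (half_pos hc)
  linarith

theorem Polynomial.exists_root_displacement_bound {D : ℕ} (B : ℝ) {Q : ℝ[X][X]}
    (hQ : Q ≠ 0) (hdeg : Q.natDegree ≤ D) :
    ∃ C > 0, ∃ δ > 0, ∀ t₀ ∈ Set.Ioo 0 δ, ∀ u₀, |u₀| ≤ B → Q.evalEval t₀ u₀ = 0 →
      ∀ᶠ p in 𝓝 (t₀, u₀), Q.evalEval p.1 p.2 = 0 →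
        |p.2 - u₀| ≤ C * t₀ ^ (1 / (D : ℝ) - 1) * |p.1 - t₀| := by
  have const : ∀ q : ℝ[X], q ≠ 0 → ∃ δ > 0, ∀ t₀ ∈ Set.Ioo 0 δ, q.eval t₀ ≠ 0 := by
    intro q hq
    have hfin : {t | q.eval t = 0}.Finite := (q.rootSet_finite ℝ).subset fun t ht => by
      simpa [mem_rootSet, hq] using ht
    obtain ⟨δ, hδ, h⟩ := mem_nhdsGT_iff_exists_Ioo_subset.1
      ((hfin.eventually_cofinite_notMem).filter_mono
        ((nhdsWithin_mono _ fun _ hx => ne_of_gt hx).trans (nhdsNE_le_cofinite (0 : ℝ))))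
    exact ⟨δ, hδ, fun t ht => h ht⟩
  have deg0 : ∀ Q : ℝ[X][X], Q ≠ 0 → Q.natDegree = 0 →
      ∃ C > 0, ∃ δ > 0, ∀ t₀ ∈ Set.Ioo 0 δ, ∀ u₀, |u₀| ≤ B → Q.evalEval t₀ u₀ = 0 →
      ∀ᶠ p in 𝓝 (t₀, u₀), Q.evalEval p.1 p.2 = 0 →
        |p.2 - u₀| ≤ C * t₀ ^ (1 / (D : ℝ) - 1) * |p.1 - t₀| := by
    intro Q hQ h0
    obtain ⟨q, rfl⟩ := natDegree_eq_zero.1 h0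
    obtain ⟨δ, hδ, h⟩ := const q (by simpa using hQ)
    refine ⟨1, one_pos, δ, hδ, fun t₀ ht u₀ _ h0 => absurd ?_ (h t₀ ht)⟩
    simpa [evalEval_C] using h0
  induction Q using WfDvdMonoid.induction_on_irreducible with
  | zero => exact absurd rfl hQ
  | unit u hu => exact deg0 u hQ (natDegree_eq_zero_of_isUnit hu)
  | mul a i ha hi ih =>
    rw [natDegree_mul hi.ne_zero ha] at hdeg
    obtain ⟨C₂, hC₂, δ₂, hδ₂, h₂⟩ := ih ha (by omega)
    obtain ⟨C₁, hC₁, δ₁, hδ₁, h₁⟩ : ∃ C > 0, ∃ δ > 0, ∀ t₀ ∈ Set.Ioo 0 δ, ∀ u₀, |u₀| ≤ B →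
        i.evalEval t₀ u₀ = 0 → ∀ᶠ p in 𝓝 (t₀, u₀), i.evalEval p.1 p.2 = 0 →
        |p.2 - u₀| ≤ C * t₀ ^ (1 / (D : ℝ) - 1) * |p.1 - t₀| := by
      by_cases hi0 : i.natDegree = 0
      · exact deg0 i hi.ne_zero hi0
      obtain ⟨Qt, hQt⟩ := i.exists_hasStrictFDerivAt_evalEval
      obtain ⟨C, hC, δ, hδ, h⟩ :=
        exists_branch_derivative_bound hi hi0 (D := D) (by omega) hQt B
      refine ⟨4 * C, by positivity, δ, hδ, fun t₀ ht u₀ hu h0 => ?_⟩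
      obtain ⟨hne, hb⟩ := h t₀ ht u₀ hu h0
      set α := Qt.evalEval t₀ u₀
      set β := (derivative i).evalEval t₀ u₀
      set A := C * t₀ ^ (1 / (D : ℝ) - 1) with hA
      have hA0 : 0 < A := mul_pos hC (Real.rpow_pos_of_pos ht.1 _)
      have hαβ : |α / β| ≤ A := by
        have : t₀ * |α / β| ≤ t₀ * A := by
          refine hb.trans_eq ?_
          rw [hA, Real.rpow_sub_one ht.1.ne']
          field_simp [ht.1.ne']
        exact le_of_mul_le_mul_left this ht.1
      have hβ : 0 < |β| := abs_pos.2 hne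
      have hlo := (hQt (t₀, u₀)).hasFDerivAt.isLittleO.bound
        (show 0 < |β| * min (1 / 2) A by positivity)
      filter_upwards [hlo] with p hp hp0
      simp only [hp0, h0, sub_zero, zero_sub, norm_neg, Real.norm_eq_abs, Prod.norm_def,
        add_apply, smul_apply, smul_eq_mul,
        ContinuousLinearMap.coe_fst', ContinuousLinearMap.coe_snd', Prod.fst_sub, Prod.snd_sub]
        at hp
      set x := p.1 - t₀
      set y := p.2 - u₀
      change |α * x + β * y| ≤ _ at hp
      have h1 : |α / β * x + y| ≤ min (1 / 2) A * max |x| |y| := by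
        refine le_of_mul_le_mul_left ?_ hβ
        rw [← mul_assoc, ← abs_mul]
        refine le_trans (le_of_eq ?_) hp
        congr 1
        field_simp
      have h2 : |y| ≤ |α / β| * |x| + |α / β * x + y| := by
        rw [← abs_mul]
        have := abs_sub (α / β * x + y) (α / β * x)
        rw [add_sub_cancel_left] at this
        linarith
      have h3 : min (1 / 2) A * max |x| |y| ≤ A * |x| + 1 / 2 * |y| := by
        rcases max_cases |x| |y| with ⟨h, -⟩ | ⟨h, -⟩ <;> rw [h]
        · have := mul_le_mul_of_nonneg_right (min_le_right (1 / 2) A) (abs_nonneg x)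
          have := abs_nonneg y
          linarith
        · have := mul_le_mul_of_nonneg_right (min_le_left (1 / 2) A) (abs_nonneg y)
          have := mul_nonneg hA0.le (abs_nonneg x)
          linarith
      have h4 := mul_le_mul_of_nonneg_right hαβ (abs_nonneg x)
      rw [show 4 * C * t₀ ^ (1 / (D : ℝ) - 1) = 4 * A by rw [hA]; ring]
      linarith
    refine ⟨max C₁ C₂, by positivity, min δ₁ δ₂, by positivity, fun t₀ ht u₀ hu h0 => ?_⟩
    have key : ∀ R : ℝ[X][X], ∀ C ≤ max C₁ C₂, (R.evalEval t₀ u₀ = 0 →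
        ∀ᶠ p in 𝓝 (t₀, u₀), R.evalEval p.1 p.2 = 0 →
          |p.2 - u₀| ≤ C * t₀ ^ (1 / (D : ℝ) - 1) * |p.1 - t₀|) →
        ∀ᶠ p in 𝓝 (t₀, u₀), R.evalEval p.1 p.2 = 0 →
          |p.2 - u₀| ≤ max C₁ C₂ * t₀ ^ (1 / (D : ℝ) - 1) * |p.1 - t₀| := by
      intro R C hC h
      by_cases hR : R.evalEval t₀ u₀ = 0
      · filter_upwards [h hR] with p hp hp0
        refine (hp hp0).trans ?_
        have := Real.rpow_nonneg ht.1.le (1 / (D : ℝ) - 1)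
        gcongr
      · have := R.continuous_evalEval.continuousAt.eventually_ne (x := (t₀, u₀)) hR
        filter_upwards [this] with p hp hp0
        exact absurd hp0 hp
    have k₁ := key i C₁ (le_max_left _ _)
      (h₁ t₀ ⟨ht.1, ht.2.trans_le (min_le_left _ _)⟩ u₀ hu)
    have k₂ := key a C₂ (le_max_right _ _)
      (h₂ t₀ ⟨ht.1, ht.2.trans_le (min_le_right _ _)⟩ u₀ hu)
    filter_upwards [k₁, k₂] with p hp₁ hp₂ hp0
    rw [evalEval_mul, mul_eq_zero] at hp0
    exact hp0.elim hp₁ hp₂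

end BivariatePolynomials

section PowerRelations

open Polynomial

/-- If `e * x i ^ E` is a polynomial of degree less than `E` in `x`, for every `i`, then every
`x i` is a root of a nonzero polynomial of degree at most `E ^ n`. -/
theorem MvPolynomial.exists_aeval_eq_zero_of_pow_relations {R A : Type*} [CommRing R] [IsDomain R]
    [CommRing A] [Algebra R A] {n : ℕ} (x : Fin n → A) {e : R} (he : e ≠ 0) {E : ℕ} (hE : 0 < E)
    (H : Fin n → MvPolynomial (Fin n) R) (hH : ∀ i, (H i).totalDegree < E)
    (hx : ∀ i, e • x i ^ E = aeval x (H i)) (i : Fin n) :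
    ∃ Q : R[X], Q ≠ 0 ∧ Q.natDegree ≤ E ^ n ∧ Polynomial.aeval (x i) Q = 0 := by
  set w : (Fin n → Fin E) → A := fun β => ∏ j, x j ^ (β j : ℕ) with hw
  set M := Submodule.span R (Set.range w)
  let S : Submodule R A :=
    { carrier := {a | ∃ k, e ^ k • a ∈ M}
      zero_mem' := ⟨0, by simp⟩
      add_mem' := by
        rintro a b ⟨k, hk⟩ ⟨l, hl⟩
        refine ⟨k + l, ?_⟩
        rw [smul_add]
        refine M.add_mem ?_ ?_
        · rw [add_comm, pow_add, mul_smul]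
          exact M.smul_mem _ hk
        · rw [pow_add, mul_smul]
          exact M.smul_mem _ hl
      smul_mem' := by
        rintro c a ⟨k, hk⟩
        exact ⟨k, by rw [smul_comm]; exact M.smul_mem _ hk⟩ }
  have hS : ∀ N, ∀ α : Fin n →₀ ℕ, α.degree = N → aeval x (monomial α (1 : R)) ∈ S := by
    intro N
    induction N using Nat.strong_induction_on with
    | _ N ih =>
      intro α hα
      by_cases hlt : ∀ j, α j < E
      · refine ⟨0, ?_⟩
        rw [pow_zero, one_smul]
        refine Submodule.subset_span ⟨fun j => ⟨α j, hlt j⟩, ?_⟩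
        simp [hw, aeval_monomial, Finsupp.prod_fintype]
      · push Not at hlt
        obtain ⟨j, hj⟩ := hlt
        have hsplit : α = Finsupp.single j E + (α - Finsupp.single j E) := by
          rw [add_tsub_cancel_of_le]
          simpa using hj
        set γ := α - Finsupp.single j E
        have hdeg : E + γ.degree = N := by
          rw [← hα, hsplit, map_add, Finsupp.degree_single]
        have h1 : e • aeval x (monomial α (1 : R)) = aeval x (H j * monomial γ 1) := by
          rw [map_mul, ← hx, hsplit, ← one_mul (1 : R), ← monomial_mul, map_mul, smul_mul_assoc]
          simp [aeval_monomial]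
        have h2 : aeval x (H j * monomial γ 1) ∈ S := by
          rw [(H j).as_sum, Finset.sum_mul, map_sum]
          refine S.sum_mem fun β hβ => ?_
          have h3 : monomial β ((H j).coeff β) * monomial γ 1 =
              ((H j).coeff β) • (monomial (β + γ) (1 : R)) := by
            rw [monomial_mul, smul_monomial, smul_eq_mul]
          rw [h3, map_smul]
          refine S.smul_mem _ (ih _ ?_ _ rfl)
          have h4 : β.degree ≤ (H j).totalDegree := le_totalDegree hβ
          rw [map_add]
          have := hH j
          omega
        rw [← h1] at h2
        obtain ⟨k, hk⟩ := h2
        exact ⟨k + 1, by rwa [pow_succ, mul_smul]⟩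
  have hmul : ∀ β, ∃ k, e ^ k • (x i * w β) ∈ M := by
    intro β
    have := hS _ (Finsupp.single i 1 + Finsupp.equivFunOnFinite.symm fun j => (β j : ℕ)) rfl
    rw [← one_mul (1 : R), ← monomial_mul, map_mul] at this
    rw [show monomial (Finsupp.single i 1) (1 : R) = X i from rfl, aeval_X] at this
    change x i * w β ∈ S
    simpa [aeval_monomial, Finsupp.prod_fintype] using this
  choose k hk using hmul
  set K := ∑ β, k β
  have hK : ∀ β, ∃ c : (Fin n → Fin E) → R, ∑ γ, c γ • w γ = e ^ K • (x i * w β) := by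
    intro β
    refine (Submodule.mem_span_range_iff_exists_fun R).1 ?_
    obtain ⟨l, hl⟩ := Nat.exists_eq_add_of_le
      (Finset.single_le_sum (f := k) (fun _ _ => Nat.zero_le _) (Finset.mem_univ β))
    rw [show K = l + k β by rw [add_comm]; exact hl, pow_add, mul_smul]
    exact M.smul_mem _ (hk β)
  choose c hc using hK
  set m : Matrix (Fin n → Fin E) (Fin n → Fin E) R := Matrix.of c
  set y := algebraMap R A (e ^ K) * x i
  have hdet : (Matrix.scalar _ y - m.map (algebraMap R A)).det = 0 := by
    set N := Matrix.scalar (Fin n → Fin E) y - m.map (algebraMap R A)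
    have hNw : N.mulVec w = 0 := by
      ext β
      have h1 := hc β
      simp only [Algebra.smul_def] at h1
      simp only [N, Matrix.sub_mulVec, Pi.sub_apply, Pi.zero_apply, Matrix.scalar_apply,
        Matrix.mulVec_diagonal, sub_eq_zero]
      simp only [y, Matrix.mulVec, dotProduct, Matrix.map_apply, m, Matrix.of_apply]
      rw [h1, mul_assoc]
    have h2 : N.det • w = 0 := by
      have := congrArg (N.adjugate.mulVec) hNw
      rwa [Matrix.mulVec_mulVec, Matrix.adjugate_mul, Matrix.smul_mulVec, Matrix.one_mulVec,
        Matrix.mulVec_zero] at this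
    simpa [hw] using congrFun h2 fun _ => ⟨0, hE⟩
  have heK : e ^ K ≠ 0 := pow_ne_zero _ he
  refine ⟨m.charpoly.comp (Polynomial.C (e ^ K) * Polynomial.X), ?_, ?_, ?_⟩
  · refine leadingCoeff_ne_zero.1 ?_
    rw [leadingCoeff_comp (by rw [natDegree_C_mul_X _ heK]; exact one_ne_zero),
      m.charpoly_monic.leadingCoeff, one_mul, leadingCoeff_C_mul_X]
    exact pow_ne_zero _ heK
  · rw [natDegree_comp, natDegree_C_mul_X _ heK, mul_one, Matrix.charpoly_natDegree_eq_dim]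
    simp
  · rw [aeval_comp, Polynomial.aeval_def, ← Polynomial.eval_map,
      ← Matrix.charpoly_map, Matrix.eval_charpoly]
    simpa [y] using hdet

end PowerRelations

section MvPolynomialCalculus

open MvPolynomial

theorem MvPolynomial.totalDegree_pderiv_le {σ R : Type*} [CommSemiring R] (i : σ)
    (p : MvPolynomial σ R) : (pderiv i p).totalDegree ≤ p.totalDegree - 1 := by
  refine Finset.sup_le fun m hm => ?_
  have h1 : m + Finsupp.single i 1 ∈ p.support := by
    rw [mem_support_iff] at hm ⊢
    rw [coeff_pderiv] at hm
    exact left_ne_zero_of_mul hm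
  have h2 : (m + Finsupp.single i 1).degree ≤ p.totalDegree := le_totalDegree h1
  rw [map_add, Finsupp.degree_single] at h2
  exact Nat.le_sub_of_add_le h2

theorem MvPolynomial.totalDegree_aeval_le {σ τ R A : Type*} [CommSemiring R] [CommSemiring A]
    [Algebra R A] (g : σ → MvPolynomial τ A) (hg : ∀ i, (g i).totalDegree ≤ 1)
    (p : MvPolynomial σ R) : (aeval g p).totalDegree ≤ p.totalDegree := by
  conv_lhs => rw [p.as_sum, map_sum]
  refine totalDegree_finsetSum_le fun m hm => ?_
  rw [aeval_monomial]
  refine (totalDegree_mul _ _).trans ?_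
  have h1 : (algebraMap R (MvPolynomial τ A) (p.coeff m)).totalDegree = 0 := by
    rw [algebraMap_apply, totalDegree_C]
  rw [h1, zero_add]
  refine (totalDegree_finsetProd _ _).trans ((Finset.sum_le_sum fun i _ => ?_).trans
    (le_totalDegree hm))
  exact (totalDegree_pow _ _).trans ((Nat.mul_le_mul_left _ (hg i)).trans_eq (mul_one _))

theorem MvPolynomial.hasDerivAt_eval {σ : Type*} [Fintype σ] (p : MvPolynomial σ ℝ)
    {c : ℝ → σ → ℝ} {c' : σ → ℝ} {s : ℝ} (hc : ∀ j, HasDerivAt (fun r => c r j) (c' j) s) :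
    HasDerivAt (fun r => eval (c r) p) (∑ j, c' j * eval (c s) (pderiv j p)) s := by
  classical
  induction p using MvPolynomial.induction_on with
  | C a => simpa using hasDerivAt_const s a
  | add p q hp hq =>
    simp only [map_add, mul_add, Finset.sum_add_distrib]
    exact hp.add hq
  | mul_X p i hp =>
    simp only [map_mul, eval_X]
    refine (hp.mul (hc i)).congr_deriv ?_
    simp [mul_add, Finset.sum_add_distrib, pderiv_X, Pi.single_apply, Finset.sum_mul,
      apply_ite, mul_assoc]
    rw [add_comm]
    congr 1
    · ring
    · exact Finset.sum_congr rfl fun _ _ => by ring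

end MvPolynomialCalculus

section Elimination

open Polynomial Filter Topology

/-- Elimination for a system of equations `e * x i ^ E = H i x` with `deg (H i) < E`. -/
theorem MvPolynomial.exists_eval₂_eq_zero_of_pow_relations {R : Type*} [CommRing R] [IsDomain R]
    {n E : ℕ} (hE : 0 < E) {e : R} (he : e ≠ 0) (H : Fin n → MvPolynomial (Fin n) R)
    (hH : ∀ i, (H i).totalDegree < E) (i : Fin n) :
    ∃ Q : R[X], Q ≠ 0 ∧ Q.natDegree ≤ E ^ n ∧ ∀ (φ : R →+* ℝ) (x : Fin n → ℝ),
      (∀ j, φ e * x j ^ E = eval₂ φ x (H j)) → Q.eval₂ φ (x i) = 0 := by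
  set I : Ideal (MvPolynomial (Fin n) R) :=
    Ideal.span (Set.range fun j => C e * X j ^ E - H j) with hI
  obtain ⟨Q, hQ0, hQdeg, hQ⟩ := exists_aeval_eq_zero_of_pow_relations
    (A := MvPolynomial (Fin n) R ⧸ I)
    (fun j => Ideal.Quotient.mkₐ R I (X j)) he hE H hH (fun j => by
      rw [← comp_aeval_apply, aeval_X_left_apply, ← map_pow, ← map_smul,
        Ideal.Quotient.mkₐ_eq_mk, Ideal.Quotient.eq, smul_eq_C_mul]
      exact Ideal.subset_span ⟨j, rfl⟩) i
  rw [Polynomial.aeval_algHom_apply, Ideal.Quotient.mkₐ_eq_mk,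
    Ideal.Quotient.eq_zero_iff_mem] at hQ
  refine ⟨Q, hQ0, hQdeg, fun φ x hx => ?_⟩
  have h1 : I ≤ RingHom.ker (eval₂Hom φ x) := by
    refine Ideal.span_le.2 ?_
    rintro _ ⟨j, rfl⟩
    simp [RingHom.mem_ker, hx j]
  have h2 : eval₂Hom φ x (Polynomial.aeval (X i) Q) = 0 := h1 hQ
  rw [Polynomial.aeval_def, Polynomial.hom_eval₂] at h2
  rw [← h2]
  congr 1
  · ext
    simp
  · simp

/-- Limits, as `ε → 0`, of the solutions of a perturbed polynomial system are roots of a nonzero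
polynomial of controlled degree. The coefficients are polynomials in `t` (the inner variable)
and `ε` (the outer variable). -/
theorem Polynomial.exists_eq_zero_of_tendsto_of_pow_relations {n E : ℕ} (hE : 0 < E) {e : ℝ[X][X]}
    (he : e ≠ 0) (H : Fin n → MvPolynomial (Fin n) ℝ[X][X]) (hH : ∀ i, (H i).totalDegree < E)
    (i : Fin n) :
    ∃ Q : ℝ[X][X], Q ≠ 0 ∧ Q.natDegree ≤ E ^ n ∧ ∀ (t u : ℝ) (ε : ℕ → ℝ) (x : ℕ → Fin n → ℝ),
      (∀ k, ε k ≠ 0) → Tendsto ε atTop (𝓝 0) → Tendsto (fun k => x k i) atTop (𝓝 u) →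
      (∀ k j, e.evalEval t (ε k) * x k j ^ E =
        MvPolynomial.eval₂ (evalEvalRingHom t (ε k)) (x k) (H j)) →
      Q.evalEval t u = 0 := by
  obtain ⟨Q, hQ0, hQdeg, hQ⟩ :=
    MvPolynomial.exists_eval₂_eq_zero_of_pow_relations hE he H hH i
  obtain ⟨m, Q₁, hQ₁, hQ₁0, hQ₁deg⟩ := exists_eq_C_X_pow_mul hQ0
  have hspec : ∀ t ε u : ℝ, eval₂RingHom (evalEvalRingHom t ε) u =
      (evalEvalRingHom ε u).comp (mapRingHom (mapRingHom (evalRingHom t))) := fun t ε u => by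
    ext <;> simp
  have hspec0 : ∀ t u : ℝ, (evalEvalRingHom t u).comp (mapRingHom (evalRingHom (0 : ℝ[X]))) =
      (evalEvalRingHom 0 u).comp (mapRingHom (mapRingHom (evalRingHom t))) := fun t u => by
    ext <;> simp
  refine ⟨Q₁.map (evalRingHom 0), hQ₁0, natDegree_map_le.trans (hQ₁deg.trans_le hQdeg), ?_⟩
  intro t u ε x hε hε0 hxu hx
  have hroot : ∀ k, (Q₁.map (mapRingHom (evalRingHom t))).evalEval (ε k) (x k i) = 0 := by
    intro k
    have h2 : eval₂RingHom (evalEvalRingHom t (ε k)) (x k i) Q = 0 :=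
      hQ _ _ (by simpa using hx k)
    rw [hQ₁, map_mul, map_pow] at h2
    have h3 : eval₂RingHom (evalEvalRingHom t (ε k)) (x k i) (C X) = ε k := by simp
    rw [h3] at h2
    have h4 := (mul_eq_zero.1 h2).resolve_left (pow_ne_zero _ (hε k))
    rw [hspec] at h4
    exact h4
  have hlim := ((continuous_evalEval (Q₁.map (mapRingHom (evalRingHom t)))).tendsto (0, u)).comp
    (hε0.prodMk_nhds hxu)
  have h0 := tendsto_nhds_unique (hlim.congr hroot) tendsto_const_nhds
  have := RingHom.congr_fun (hspec0 t u) Q₁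
  exact this.trans h0

end Elimination

section Minimizers

open MvPolynomial Filter Topology

theorem MvPolynomial.eq_or_eq_or_eval_pderiv_eq_zero_of_isMinOn {σ : Type*} [Fintype σ]
    {p : MvPolynomial σ ℝ} {l b x : σ → ℝ} (hx : x ∈ Set.Icc l b)
    (hmin : IsMinOn (fun z => eval z p) (Set.Icc l b) x) (j : σ) :
    x j = l j ∨ x j = b j ∨ eval x (pderiv j p) = 0 := by
  classical
  by_contra! h
  obtain ⟨hl, hb, hp⟩ := h
  have hl' : l j < x j := lt_of_le_of_ne (hx.1 j) hl.symm
  have hb' : x j < b j := lt_of_le_of_ne (hx.2 j) hb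
  have hderiv := hasDerivAt_eval p (c := fun s => Function.update x j s) (c' := Pi.single j 1)
    (s := x j) (fun i => by
      by_cases hij : i = j
      · subst hij
        simpa using hasDerivAt_id' (x i)
      · simpa [hij] using hasDerivAt_const (x j) (x i))
  have hloc : IsLocalMin (fun s => eval (Function.update x j s) p) (x j) := by
    filter_upwards [Ioo_mem_nhds hl' hb'] with s hs
    rw [Function.update_eq_self]
    refine hmin ⟨fun i => ?_, fun i => ?_⟩
    · by_cases hij : i = j
      · subst hij
        simpa using hs.1.le
      · simpa [hij] using hx.1 i
    · by_cases hij : i = j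
      · subst hij
        simpa using hs.2.le
      · simpa [hij] using hx.2 i
  have := hloc.hasDerivAt_eq_zero hderiv
  simp [Pi.single_apply] at this
  exact hp this

/-- The squared norm of the gradient of `P` with respect to all variables but the last one. -/
noncomputable def MvPolynomial.sqNormGrad {n : ℕ} (P : MvPolynomial (Fin (n + 1)) ℝ)
    (x : Fin n → ℝ) (t : ℝ) : ℝ :=
  ∑ i : Fin n, eval (Fin.snoc x t : Fin (n + 1) → ℝ) (pderiv i.castSucc P) ^ 2

theorem MvPolynomial.continuous_eval_snoc {n : ℕ} (P : MvPolynomial (Fin (n + 1)) ℝ) :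
    Continuous fun p : (Fin n → ℝ) × ℝ => eval (Fin.snoc p.1 p.2 : Fin (n + 1) → ℝ) P :=
  (continuous_eval P).comp (Continuous.finSnoc continuous_fst continuous_snd)

theorem MvPolynomial.continuous_sqNormGrad {n : ℕ} (P : MvPolynomial (Fin (n + 1)) ℝ) :
    Continuous fun p : (Fin n → ℝ) × ℝ => P.sqNormGrad p.1 p.2 :=
  continuous_finsetSum _ fun _ _ => (continuous_eval_snoc _).pow 2

/-- A polynomial in `x`, with coefficients depending on `t` and `ε`, whose values are
`ε * |∇ₓ P| ^ 2 + P ^ 2`. -/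
theorem MvPolynomial.exists_penalized_sqNormGrad {n d : ℕ}
    (P : MvPolynomial (Fin (n + 1)) ℝ) (hP : P.totalDegree ≤ d) :
    ∃ Φ : MvPolynomial (Fin n) (Polynomial (Polynomial ℝ)), Φ.totalDegree ≤ 2 * d ∧
      ∀ (t ε : ℝ) (x : Fin n → ℝ), eval x (map (Polynomial.evalEvalRingHom t ε) Φ) =
        ε * P.sqNormGrad x t + eval (Fin.snoc x t : Fin (n + 1) → ℝ) P ^ 2 := by
  set g : Fin (n + 1) → MvPolynomial (Fin n) (Polynomial (Polynomial ℝ)) :=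
    Fin.snoc X (C (Polynomial.C Polynomial.X)) with hg
  have hg1 : ∀ i, (g i).totalDegree ≤ 1 := by
    intro i
    refine Fin.lastCases ?_ (fun j => ?_) i
    · simp [hg]
    · simp [hg, totalDegree_X]
  have hgeval : ∀ (t ε : ℝ) (x : Fin n → ℝ) (p : MvPolynomial (Fin (n + 1)) ℝ),
      eval x (map (Polynomial.evalEvalRingHom t ε) (aeval g p)) =
        eval (Fin.snoc x t : Fin (n + 1) → ℝ) p := by
    intro t ε x p
    induction p using MvPolynomial.induction_on with
    | C a => simp [algebraMap_apply]
    | add p q hp hq => rw [map_add, map_add, map_add, map_add, hp, hq]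
    | mul_X p i hp =>
      rw [map_mul, map_mul, map_mul, map_mul, hp, aeval_X, eval_X]
      congr 1
      refine Fin.lastCases ?_ (fun j => ?_) i
      · simp [hg]
      · simp [hg]
  refine ⟨C Polynomial.X * ∑ i : Fin n, (aeval g (pderiv i.castSucc P)) ^ 2 + (aeval g P) ^ 2,
    ?_, ?_⟩
  · have hsq : ∀ p : MvPolynomial (Fin (n + 1)) ℝ, p.totalDegree ≤ d →
        ((aeval g p) ^ 2).totalDegree ≤ 2 * d := fun p hp =>
      (totalDegree_pow _ _).trans (Nat.mul_le_mul_left _ ((totalDegree_aeval_le g hg1 p).trans hp))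
    refine (totalDegree_add _ _).trans (max_le ((totalDegree_mul _ _).trans ?_) (hsq P hP))
    rw [totalDegree_C, zero_add]
    refine totalDegree_finsetSum_le fun i _ => hsq _ ?_
    exact (totalDegree_pderiv_le _ _).trans ((Nat.sub_le _ _).trans hP)
  · intro t ε x
    simp only [map_add, map_mul, map_pow, map_sum, hgeval, sqNormGrad, map_C, eval_C]
    simp

/-- Elimination for the critical equations, on the faces of a box, of a polynomial `Φ` perturbed
by a multiple of `∑ i, x i ^ (E + 1)`. -/
theorem MvPolynomial.exists_eq_zero_of_tendsto_of_critical {n E : ℕ} (hE : 0 < E)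
    (Φ : MvPolynomial (Fin n) (Polynomial (Polynomial ℝ))) (hΦ : Φ.totalDegree ≤ E)
    (c : Fin n → ℝ) (σ : Fin n → SignType) (i : Fin n) :
    ∃ Q : Polynomial (Polynomial ℝ), Q ≠ 0 ∧ Q.natDegree ≤ E ^ n ∧
      ∀ (t u : ℝ) (ε : ℕ → ℝ) (x : ℕ → Fin n → ℝ), (∀ k, ε k ≠ 0) → Tendsto ε atTop (𝓝 0) →
        Tendsto (fun k => x k i) atTop (𝓝 u) →
        (∀ k j, if σ j = 0 then ε k ^ 2 * x k j ^ E +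
            eval (x k) (map (Polynomial.evalEvalRingHom t (ε k)) (pderiv j Φ)) = 0
          else x k j = c j) → Q.evalEval t u = 0 := by
  set e : Polynomial (Polynomial ℝ) := Polynomial.X ^ 2 with he
  have heval : ∀ t ε, e.evalEval t ε = ε ^ 2 := fun t ε => by simp [he, Polynomial.evalEval]
  set H : Fin n → MvPolynomial (Fin n) (Polynomial (Polynomial ℝ)) :=
    fun j => if σ j = 0 then -pderiv j Φ else
      C (Polynomial.C (Polynomial.C (c j)) * e) * X j ^ (E - 1) with hH
  have hHdeg : ∀ j, (H j).totalDegree < E := by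
    intro j
    simp only [hH]
    split_ifs
    · rw [totalDegree_neg]
      have := totalDegree_pderiv_le j Φ
      omega
    · refine ((totalDegree_mul _ _).trans_eq ?_).trans_lt (show E - 1 < E by omega)
      rw [totalDegree_C, totalDegree_X_pow, zero_add]
  obtain ⟨Q, hQ0, hQdeg, hQ⟩ :=
    Polynomial.exists_eq_zero_of_tendsto_of_pow_relations hE (pow_ne_zero 2 Polynomial.X_ne_zero)
      H hHdeg i
  refine ⟨Q, hQ0, hQdeg, fun t u ε x hε hε0 hu hx => hQ t u ε x hε hε0 hu fun k j => ?_⟩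
  rw [heval]
  have hxk := hx k j
  simp only [hH]
  split_ifs at hxk ⊢ with hj
  · rw [← coe_eval₂Hom, map_neg, coe_eval₂Hom, ← eval_map]
    linarith
  · have h1 : Polynomial.evalEvalRingHom t (ε k) (Polynomial.C (Polynomial.C (c j)) * e) =
        c j * ε k ^ 2 := by
      rw [map_mul, Polynomial.coe_evalEvalRingHom, heval]
      simp
    rw [eval₂_mul, eval₂_C, eval₂_pow, eval₂_X, h1, hxk, mul_right_comm, ← pow_succ',
      Nat.sub_add_cancel hE, mul_comm]

/-- Minimizing over a box a polynomial perturbed by a multiple of `∑ i, x i ^ (E + 1)`. -/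
theorem MvPolynomial.exists_isMinOn_perturbation {n : ℕ} (E : ℕ) (Ψ : MvPolynomial (Fin n) ℝ)
    (ε : ℝ) {l b : Fin n → ℝ} (hlb : (Set.Icc l b).Nonempty) :
    ∃ x ∈ Set.Icc l b, (∀ z ∈ Set.Icc l b,
        eval x Ψ + ε ^ 2 * ∑ i, ((E + 1 : ℕ) : ℝ)⁻¹ * x i ^ (E + 1) ≤
          eval z Ψ + ε ^ 2 * ∑ i, ((E + 1 : ℕ) : ℝ)⁻¹ * z i ^ (E + 1)) ∧
      ∃ σ : Fin n → SignType, ∀ j, if σ j = 0 then ε ^ 2 * x j ^ E + eval x (pderiv j Ψ) = 0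
        else x j = if σ j = 1 then b j else l j := by
  set T : MvPolynomial (Fin n) ℝ := ∑ i, C ((E + 1 : ℕ) : ℝ)⁻¹ * X i ^ (E + 1) with hT
  have hTderiv : ∀ j, pderiv j T = X j ^ E := by
    intro j
    have h0 : ((E + 1 : ℕ) : ℝ) ≠ 0 := by positivity
    rw [hT, map_sum, Finset.sum_eq_single j]
    · rw [pderiv_C_mul, pderiv_pow, pderiv_X_self, mul_one, Nat.add_sub_cancel, ← mul_assoc,
        ← map_natCast (C (σ := Fin n) (R := ℝ)), ← C_mul, inv_mul_cancel₀ h0, C_1, one_mul]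
    · intro i _ hij
      rw [pderiv_C_mul, pderiv_pow, pderiv_X_of_ne hij, mul_zero, mul_zero]
    · simp
  have heval : ∀ z, eval z (Ψ + C (ε ^ 2) * T) =
      eval z Ψ + ε ^ 2 * ∑ i, ((E + 1 : ℕ) : ℝ)⁻¹ * z i ^ (E + 1) := fun z => by
    rw [map_add, map_mul, eval_C, hT, map_sum]
    simp only [map_mul, eval_C, map_pow, eval_X]
  obtain ⟨x, hx, hmin⟩ := isCompact_Icc.exists_isMinOn hlb
    (f := fun z => eval z (Ψ + C (ε ^ 2) * T)) (continuous_eval _).continuousOn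
  refine ⟨x, hx, fun z hz => ?_, ?_⟩
  · rw [← heval, ← heval]
    exact hmin hz
  · have hj : ∀ j, ∃ s : SignType, if s = 0 then ε ^ 2 * x j ^ E + eval x (pderiv j Ψ) = 0
        else x j = if s = 1 then b j else l j := by
      intro j
      rcases eq_or_eq_or_eval_pderiv_eq_zero_of_isMinOn hx hmin j with h | h | h
      · exact ⟨-1, by simpa using h⟩
      · exact ⟨1, by simpa using h⟩
      · refine ⟨0, ?_⟩
        rw [map_add, pderiv_C_mul, hTderiv, map_add, map_mul, eval_C, map_pow, eval_X] at h
        rw [if_pos rfl]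
        linarith
    choose s hs using hj
    exact ⟨s, hs⟩

/-- On every level of the last variable, some minimizer over a box of the squared norm of the
horizontal gradient has its coordinates on algebraic curves of controlled degree. -/
theorem MvPolynomial.exists_minimizer_sqNormGrad {n d : ℕ} (hd : 1 ≤ d)
    (P : MvPolynomial (Fin (n + 1)) ℝ) (hP : P.totalDegree ≤ d) (l b : Fin n → ℝ) :
    ∃ Q : (Fin n → SignType) → Fin n → Polynomial (Polynomial ℝ),
      (∀ σ i, Q σ i ≠ 0 ∧ (Q σ i).natDegree ≤ (2 * d) ^ n) ∧
      ∀ t, (∃ z ∈ Set.Icc l b, eval (Fin.snoc z t : Fin (n + 1) → ℝ) P = 0) →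
        ∃ σ, ∃ x ∈ Set.Icc l b, eval (Fin.snoc x t : Fin (n + 1) → ℝ) P = 0 ∧
          (∀ z ∈ Set.Icc l b, eval (Fin.snoc z t : Fin (n + 1) → ℝ) P = 0 →
            P.sqNormGrad x t ≤ P.sqNormGrad z t) ∧
          ∀ i, (Q σ i).evalEval t (x i) = 0 := by
  obtain ⟨Φ, hΦdeg, hΦeval⟩ := P.exists_penalized_sqNormGrad hP
  set c : (Fin n → SignType) → Fin n → ℝ := fun σ j => if σ j = 1 then b j else l j with hc
  choose Q hQ0 hQdeg hQ using fun σ =>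
    exists_eq_zero_of_tendsto_of_critical (show 0 < 2 * d by omega) Φ hΦdeg (c σ) σ
  refine ⟨Q, fun σ i => ⟨hQ0 σ i, hQdeg σ i⟩, fun t ⟨z₀, hz₀, hPz₀⟩ => ?_⟩
  set T : (Fin n → ℝ) → ℝ := fun z => ∑ i, ((2 * d + 1 : ℕ) : ℝ)⁻¹ * z i ^ (2 * d + 1) with hT
  have hTc : Continuous T := by fun_prop
  set ε : ℕ → ℝ := fun k => 1 / ((k : ℝ) + 1)
  have hεpos : ∀ k, 0 < ε k := fun k => Nat.one_div_pos_of_nat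
  have hε0 : Tendsto ε atTop (𝓝 0) := tendsto_one_div_add_atTop_nhds_zero_nat
  choose x hxmem hxmin σ hσ using fun k => exists_isMinOn_perturbation (2 * d)
    (map (Polynomial.evalEvalRingHom t (ε k)) Φ) (ε k) ⟨z₀, hz₀⟩
  simp only [hΦeval, pderiv_map] at hxmin hσ
  obtain ⟨⟨x₀, σ₀⟩, ⟨hx₀, -⟩, φ, hφ, hlim⟩ :=
    (isCompact_Icc.prod (isCompact_univ (X := Fin n → SignType))).tendsto_subseq
      (x := fun k => (x k, σ k)) fun k => ⟨hxmem k, trivial⟩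
  have hxlim : Tendsto (x ∘ φ) atTop (𝓝 x₀) := (continuous_fst.tendsto _).comp hlim
  have hσlim : Tendsto (σ ∘ φ) atTop (𝓝 σ₀) := (continuous_snd.tendsto _).comp hlim
  have hεφ : Tendsto (ε ∘ φ) atTop (𝓝 0) := hε0.comp hφ.tendsto_atTop
  have hcmp : ∀ k, ∀ z ∈ Set.Icc l b, eval (Fin.snoc z t : Fin (n + 1) → ℝ) P = 0 →
      ε k * P.sqNormGrad (x k) t + eval (Fin.snoc (x k) t : Fin (n + 1) → ℝ) P ^ 2 +
        ε k ^ 2 * T (x k) ≤ ε k * P.sqNormGrad z t + ε k ^ 2 * T z := by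
    intro k z hz hPz
    have := hxmin k z hz
    rwa [hPz, zero_pow two_ne_zero, add_zero] at this
  have hSlim : Tendsto (fun k => P.sqNormGrad (x (φ k)) t) atTop (𝓝 (P.sqNormGrad x₀ t)) :=
    ((P.continuous_sqNormGrad.comp (Continuous.prodMk_left t)).tendsto x₀).comp hxlim
  have hTlim : Tendsto (fun k => T (x (φ k))) atTop (𝓝 (T x₀)) :=
    (hTc.tendsto x₀).comp hxlim
  have hPlim : Tendsto (fun k => eval (Fin.snoc (x (φ k)) t : Fin (n + 1) → ℝ) P) atTop
      (𝓝 (eval (Fin.snoc x₀ t : Fin (n + 1) → ℝ) P)) :=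
    ((P.continuous_eval_snoc.comp (Continuous.prodMk_left t)).tendsto x₀).comp hxlim
  refine ⟨σ₀, x₀, hx₀, ?_, fun z hz hPz => ?_, fun i => ?_⟩
  · have h1 := ((hεφ.mul hSlim).add (hPlim.pow 2)).add ((hεφ.pow 2).mul hTlim)
    have h2 := (hεφ.mul_const (P.sqNormGrad z₀ t)).add ((hεφ.pow 2).mul_const (T z₀))
    have h3 := le_of_tendsto_of_tendsto' h1 h2 fun k => hcmp (φ k) z₀ hz₀ hPz₀
    simp at h3
    exact pow_eq_zero_iff two_ne_zero |>.1 (le_antisymm (by simpa using h3) (sq_nonneg _))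
  · have h1 := hSlim.add (hεφ.mul hTlim)
    have h2 := (tendsto_const_nhds (x := P.sqNormGrad z t)).add (hεφ.mul_const (T z))
    have h3 := le_of_tendsto_of_tendsto' h1 h2 fun k => by
      have h4 := hcmp (φ k) z hz hPz
      have h5 := sq_nonneg (eval (Fin.snoc (x (φ k)) t : Fin (n + 1) → ℝ) P)
      refine le_of_mul_le_mul_left ?_ (hεpos (φ k))
      simp only [Function.comp]
      linarith
    simpa using h3
  · have hev : ∀ᶠ k in atTop, σ (φ k) = σ₀ := by
      have : {σ₀} ∈ 𝓝 σ₀ := by simp [nhds_discrete]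
      exact hσlim this
    obtain ⟨N, hN⟩ := eventually_atTop.1 hev
    have hxi : Tendsto (fun k => x (φ (k + N)) i) atTop (𝓝 (x₀ i)) :=
      (tendsto_add_atTop_iff_nat (f := fun k => x (φ k) i) N).2
        (((continuous_apply i).tendsto x₀).comp hxlim)
    refine hQ σ₀ i t (x₀ i) (fun k => ε (φ (k + N))) (fun k => x (φ (k + N)))
      (fun k => (hεpos _).ne') ((tendsto_add_atTop_iff_nat N).2 hεφ) hxi fun k j => ?_
    have := hσ (φ (k + N)) j
    rwa [show σ (φ (k + N)) = σ₀ from hN (k + N) (Nat.le_add_left _ _)] at this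

end Minimizers

section GradientIdentity

open MvPolynomial Filter Topology

theorem one_le_mul_norm_gradient {F : Type*} [NormedAddCommGroup F] [InnerProductSpace ℝ F]
    [CompleteSpace F] {f : F → ℝ} {x₀ : F} (hf : DifferentiableAt ℝ f x₀) {x : ℕ → F}
    (hx : Tendsto x atTop (𝓝 x₀)) {L : ℝ} (hL : 0 ≤ L)
    (hle : ∀ᶠ k in atTop, ‖x k - x₀‖ ≤ L * |f (x k) - f x₀|) (hne : ∀ k, f (x k) ≠ f x₀) :
    1 ≤ L * ‖gradient f x₀‖ := by
  by_contra! hlt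
  set η := (1 - L * ‖gradient f x₀‖) / (L + 1) with hη
  have hη0 : 0 < η := div_pos (by linarith) (by linarith)
  have hηeq : η * (L + 1) = 1 - L * ‖gradient f x₀‖ := div_mul_cancel₀ _ (by linarith)
  have hgrad := hf.hasGradientAt.hasFDerivAt
  have hev := hx.eventually ((hasFDerivAt_iff_isLittleO.1 hgrad).def hη0)
  obtain ⟨k, h1, h2⟩ := (hev.and hle).exists
  rw [Real.norm_eq_abs] at h1
  have h3 : |(InnerProductSpace.toDual ℝ F) (gradient f x₀) (x k - x₀)| ≤
      ‖gradient f x₀‖ * ‖x k - x₀‖ := by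
    rw [InnerProductSpace.toDual_apply_apply]
    exact abs_real_inner_le_norm _ _
  have h4 : 0 < |f (x k) - f x₀| := abs_pos.2 (sub_ne_zero.2 (hne k))
  have h5 : |f (x k) - f x₀| ≤ (η + ‖gradient f x₀‖) * ‖x k - x₀‖ := by
    have := abs_sub_abs_le_abs_sub (f (x k) - f x₀)
      ((InnerProductSpace.toDual ℝ F) (gradient f x₀) (x k - x₀))
    linarith
  have h6 : |f (x k) - f x₀| ≤ ((η + ‖gradient f x₀‖) * L) * |f (x k) - f x₀| := by
    rw [mul_assoc]
    exact h5.trans (mul_le_mul_of_nonneg_left h2 (by positivity))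
  have h7 : 1 ≤ (η + ‖gradient f x₀‖) * L :=
    le_of_mul_le_mul_right (by rwa [one_mul]) h4
  nlinarith

theorem MvPolynomial.eval_pderiv_castSucc_eq_of_eventually_eval_eq_zero {n : ℕ}
    {P : MvPolynomial (Fin (n + 1)) ℝ} {f : EuclideanSpace ℝ (Fin n) → ℝ}
    {x : EuclideanSpace ℝ (Fin n)} (hf : DifferentiableAt ℝ f x)
    (hP : ∀ᶠ y in 𝓝 x, eval (Fin.snoc (fun i => y i) (f y) : Fin (n + 1) → ℝ) P = 0) (i : Fin n) :
    eval (Fin.snoc (fun i => x i) (f x) : Fin (n + 1) → ℝ) (pderiv i.castSucc P) =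
      -(eval (Fin.snoc (fun i => x i) (f x) : Fin (n + 1) → ℝ) (pderiv (Fin.last n) P) *
        gradient f x i) := by
  set y : ℝ → EuclideanSpace ℝ (Fin n) := fun s => x + s • EuclideanSpace.single i (1 : ℝ) with hy
  have hy0 : y 0 = x := by simp [hy]
  have hyd : HasDerivAt y (EuclideanSpace.single i (1 : ℝ)) 0 := by
    exact (((hasDerivAt_id' (0 : ℝ)).smul_const (EuclideanSpace.single i (1 : ℝ))).const_add
      x).congr_deriv (one_smul _ _)
  have hgrad : HasGradientAt f (gradient f x) (y 0) := by
    rw [hy0]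
    exact hf.hasGradientAt
  have hfd : HasDerivAt (fun s => f (y s)) (gradient f x i) 0 := by
    refine (hgrad.hasFDerivAt.comp_hasDerivAt 0 hyd).congr_deriv ?_
    rw [InnerProductSpace.toDual_apply_apply, EuclideanSpace.inner_single_right]
    simp
  have hderiv := hasDerivAt_eval P
    (c := fun s => (Fin.snoc (fun i => y s i) (f (y s)) : Fin (n + 1) → ℝ))
    (c' := (Fin.snoc (Pi.single i 1) (gradient f x i) : Fin (n + 1) → ℝ)) (s := 0) (fun j => by
      refine Fin.lastCases ?_ (fun j => ?_) j
      · simpa using hfd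
      · simp only [Fin.snoc_castSucc, hy]
        by_cases hij : j = i
        · subst hij
          simpa using (hasDerivAt_id' (0 : ℝ)).const_add (x j)
        · simpa [hij] using hasDerivAt_const (0 : ℝ) (x j))
  have hzero : (fun s => eval (Fin.snoc (fun i => y s i) (f (y s)) : Fin (n + 1) → ℝ) P) =ᶠ[𝓝 0]
      fun _ => 0 := by
    have := hyd.continuousAt.tendsto
    rw [hy0] at this
    exact this.eventually hP
  have hsum := hderiv.unique ((hasDerivAt_const (0 : ℝ) (0 : ℝ)).congr_of_eventuallyEq hzero)
  rw [Fin.sum_univ_castSucc] at hsum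
  simp [Pi.single_apply, hy0] at hsum
  linarith

theorem MvPolynomial.sqNormGrad_eq_of_eventually_eval_eq_zero {n : ℕ}
    {P : MvPolynomial (Fin (n + 1)) ℝ} {f : EuclideanSpace ℝ (Fin n) → ℝ}
    {x : EuclideanSpace ℝ (Fin n)} (hf : DifferentiableAt ℝ f x)
    (hP : ∀ᶠ y in 𝓝 x, eval (Fin.snoc (fun i => y i) (f y) : Fin (n + 1) → ℝ) P = 0) :
    P.sqNormGrad (fun i => x i) (f x) =
      (eval (Fin.snoc (fun i => x i) (f x) : Fin (n + 1) → ℝ) (pderiv (Fin.last n) P) *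
        ‖gradient f x‖) ^ 2 := by
  rw [mul_pow, EuclideanSpace.real_norm_sq_eq, Finset.mul_sum, sqNormGrad]
  refine Finset.sum_congr rfl fun i _ => ?_
  rw [eval_pderiv_castSucc_eq_of_eventually_eval_eq_zero hf hP, neg_sq, mul_pow]

theorem MvPolynomial.hasDerivAt_eval_snoc {n : ℕ} (P : MvPolynomial (Fin (n + 1)) ℝ)
    (x : Fin n → ℝ) (s : ℝ) :
    HasDerivAt (fun s => eval (Fin.snoc x s : Fin (n + 1) → ℝ) P)
      (eval (Fin.snoc x s : Fin (n + 1) → ℝ) (pderiv (Fin.last n) P)) s := by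
  have := hasDerivAt_eval P (c := fun s => (Fin.snoc x s : Fin (n + 1) → ℝ))
    (c' := Pi.single (Fin.last n) 1) (s := s) (fun j => by
      refine Fin.lastCases ?_ (fun j => ?_) j
      · simpa using hasDerivAt_id' s
      · simpa using hasDerivAt_const s (x j))
  simpa [Pi.single_apply] using this

theorem MvPolynomial.injOn_zeros_of_eval_pderiv_ne_zero {n : ℕ} {P : MvPolynomial (Fin (n + 1)) ℝ}
    {x : Fin n → ℝ} {I : Set ℝ} (hI : I.OrdConnected)
    (hP : ∀ s ∈ I, eval (Fin.snoc x s : Fin (n + 1) → ℝ) (pderiv (Fin.last n) P) ≠ 0)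
    {s t : ℝ} (hs : s ∈ I) (ht : t ∈ I) (hPs : eval (Fin.snoc x s : Fin (n + 1) → ℝ) P = 0)
    (hPt : eval (Fin.snoc x t : Fin (n + 1) → ℝ) P = 0) : s = t := by
  have key : ∀ u ∈ I, ∀ v ∈ I, eval (Fin.snoc x u : Fin (n + 1) → ℝ) P = 0 →
      eval (Fin.snoc x v : Fin (n + 1) → ℝ) P = 0 → ¬ u < v := by
    intro u hu v hv hPu hPv huv
    obtain ⟨c, hc, hc0⟩ := exists_hasDerivAt_eq_zero huv
      (fun s _ => (P.hasDerivAt_eval_snoc x s).continuousAt.continuousWithinAt)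
      (hPu.trans hPv.symm) (fun s _ => P.hasDerivAt_eval_snoc x s)
    exact hP c (hI.out hu hv (Set.Ioo_subset_Icc_self hc)) hc0
  exact le_antisymm (not_lt.1 (key t ht s hs hPt hPs)) (not_lt.1 (key s hs t ht hPs hPt))

theorem exists_Icc_mem_nhds_pi {ι : Type*} [Fintype ι] {a : ι → ℝ} {s : Set (ι → ℝ)}
    (hs : s ∈ 𝓝 a) : ∃ l b : ι → ℝ, Set.Icc l b ∈ 𝓝 a ∧ Set.Icc l b ⊆ s := by
  obtain ⟨r, hr, hrs⟩ := Metric.nhds_basis_closedBall.mem_iff.1 hs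
  have h : Set.Icc (fun i => a i - r) (fun i => a i + r) = Metric.closedBall a r := by
    rw [closedBall_pi a hr.le, ← Set.pi_univ_Icc]
    simp_rw [Real.closedBall_eq_Icc]
  exact ⟨_, _, h ▸ Metric.closedBall_mem_nhds a hr, h ▸ hrs⟩

/-- Near a point where the last partial derivative of `P` does not vanish, the zero set of `P` is
the graph of `f`. -/
theorem MvPolynomial.exists_box_graph {n : ℕ} {P : MvPolynomial (Fin (n + 1)) ℝ}
    {f : EuclideanSpace ℝ (Fin n) → ℝ} {U : Set (EuclideanSpace ℝ (Fin n))} (hU : IsOpen U)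
    {a : EuclideanSpace ℝ (Fin n)} (ha : a ∈ U) (hf : ContinuousAt f a) (hfa : f a = 0)
    (hPf : ∀ x ∈ U, eval (Fin.snoc (fun i => x i) (f x) : Fin (n + 1) → ℝ) P = 0)
    (hPy : eval (Fin.snoc (fun i => a i) (f a) : Fin (n + 1) → ℝ) (pderiv (Fin.last n) P) ≠ 0) :
    ∃ l b : Fin n → ℝ, ∃ δ > 0, ∃ K > 0, (∀ᶠ x in 𝓝 a, x.ofLp ∈ Set.Icc l b) ∧
      ∀ x : EuclideanSpace ℝ (Fin n), x.ofLp ∈ Set.Icc l b → x ∈ U ∧ ∀ t, |t| < δ →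
        (eval (Fin.snoc x.ofLp t : Fin (n + 1) → ℝ) P = 0 → f x = t) ∧
        (f x = t → eval (Fin.snoc x.ofLp t : Fin (n + 1) → ℝ) P = 0) ∧
        K ≤ |eval (Fin.snoc x.ofLp t : Fin (n + 1) → ℝ) (pderiv (Fin.last n) P)| ∧
        |eval (Fin.snoc x.ofLp t : Fin (n + 1) → ℝ) (pderiv (Fin.last n) P)| ≤ 4 * K := by
  set m := |eval (Fin.snoc (fun i => a i) (f a) : Fin (n + 1) → ℝ) (pderiv (Fin.last n) P)| with hm
  have hm0 : 0 < m := abs_pos.2 hPy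
  have hcont : Continuous fun p : (Fin n → ℝ) × ℝ =>
      |eval (Fin.snoc p.1 p.2 : Fin (n + 1) → ℝ) (pderiv (Fin.last n) P)| :=
    (continuous_eval_snoc _).abs
  have hev : ∀ᶠ p : (Fin n → ℝ) × ℝ in 𝓝 (a.ofLp) ×ˢ 𝓝 (0 : ℝ),
      |eval (Fin.snoc p.1 p.2 : Fin (n + 1) → ℝ) (pderiv (Fin.last n) P)| ∈
        Set.Ioo (m / 2) (2 * m) := by
    rw [← nhds_prod_eq]
    refine hcont.continuousAt (x := (a.ofLp, (0 : ℝ))) (Ioo_mem_nhds ?_ ?_)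
    all_goals
      rw [hfa] at hm
      rw [← hm]
      linarith
  obtain ⟨s, hs, T, hT, hsT⟩ := Filter.eventually_prod_iff.1 hev
  obtain ⟨δ, hδ, hδT⟩ := Metric.eventually_nhds_iff.1 hT
  have hUf : ∀ᶠ x in 𝓝 a, x ∈ U ∧ |f x| < δ := by
    have := hf.tendsto.abs
    rw [hfa, abs_zero] at this
    exact (show ∀ᶠ x in 𝓝 a, x ∈ U from hU.mem_nhds ha).and (this.eventually_lt_const hδ)
  have hUf' : ∀ᶠ y : Fin n → ℝ in 𝓝 a.ofLp,
      s y ∧ WithLp.toLp 2 y ∈ U ∧ |f (WithLp.toLp 2 y)| < δ :=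
    hs.and (((PiLp.continuous_toLp 2 _).tendsto a.ofLp).eventually hUf)
  obtain ⟨l, b, hlb, hsub⟩ := exists_Icc_mem_nhds_pi hUf'
  refine ⟨l, b, δ, hδ, m / 2, by positivity, ((PiLp.continuous_ofLp 2 _).tendsto a) hlb,
    fun x hx => ?_⟩
  obtain ⟨hsx, hxU, hfx⟩ := hsub hx
  have hbd : ∀ t, |t| < δ → |eval (Fin.snoc x.ofLp t : Fin (n + 1) → ℝ)
      (pderiv (Fin.last n) P)| ∈ Set.Ioo (m / 2) (2 * m) := fun t ht =>
    hsT hsx (hδT (by simpa using ht))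
  refine ⟨hxU, fun t ht => ⟨fun hPt => ?_, ?_, (hbd t ht).1.le, ?_⟩⟩
  · refine injOn_zeros_of_eval_pderiv_ne_zero (I := Set.Ioo (-δ) δ) (x := x.ofLp)
      Set.ordConnected_Ioo (fun u hu h0 => ?_) (abs_lt.1 hfx) (abs_lt.1 ht) (hPf x hxU) hPt
    have := (hbd u (abs_lt.2 hu)).1
    rw [h0, abs_zero] at this
    linarith
  · rintro rfl
    exact hPf x hxU
  · linarith [(hbd t ht).2]

end GradientIdentity

section LevelSets

open MvPolynomial Filter Topology

theorem EuclideanSpace.norm_le_sum_abs {ι : Type*} [Fintype ι] (x : EuclideanSpace ℝ ι) :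
    ‖x‖ ≤ ∑ i, |x i| := by
  rw [EuclideanSpace.norm_eq, Real.sqrt_le_iff]
  refine ⟨Finset.sum_nonneg fun i _ => abs_nonneg _, ?_⟩
  rw [sq, Finset.sum_mul]
  refine Finset.sum_le_sum fun i hi => ?_
  rw [Real.norm_eq_abs, sq]
  exact mul_le_mul_of_nonneg_left
    (Finset.single_le_sum (f := fun i => |x i|) (fun _ _ => abs_nonneg _) hi) (abs_nonneg _)

theorem Polynomial.exists_norm_displacement_bound {κ ι : Type*} [Fintype κ] [Fintype ι] {D : ℕ}
    (B : ℝ) {Q : κ → ι → Polynomial (Polynomial ℝ)}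
    (hQ : ∀ σ i, Q σ i ≠ 0 ∧ (Q σ i).natDegree ≤ D) :
    ∃ M > 0, ∃ δ > 0, ∀ t₀ ∈ Set.Ioo 0 δ, ∀ σ, ∀ x₀ : EuclideanSpace ℝ ι, (∀ i, |x₀ i| ≤ B) →
      (∀ i, (Q σ i).evalEval t₀ (x₀ i) = 0) → ∀ᶠ p : EuclideanSpace ℝ ι × ℝ in 𝓝 (x₀, t₀),
        (∀ i, (Q σ i).evalEval p.2 (p.1 i) = 0) →
          ‖p.1 - x₀‖ ≤ M * t₀ ^ (1 / (D : ℝ) - 1) * |p.2 - t₀| := by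
  choose C hC δ hδ h using fun σ i => exists_root_displacement_bound B (hQ σ i).1 (hQ σ i).2
  have hM : ∀ σ, ∑ i, C σ i ≤ ∑ σ, ∑ i, C σ i := fun σ =>
    Finset.single_le_sum (f := fun σ => ∑ i, C σ i)
      (fun σ _ => Finset.sum_nonneg fun i _ => (hC σ i).le) (Finset.mem_univ σ)
  have hM0 : 0 ≤ ∑ σ, ∑ i, C σ i :=
    Finset.sum_nonneg fun σ _ => Finset.sum_nonneg fun i _ => (hC σ i).le
  have hδ' : ∀ᶠ s in 𝓝 (0 : ℝ), ∀ σ i, s < δ σ i :=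
    eventually_all.2 fun σ => eventually_all.2 fun i => eventually_lt_nhds (hδ σ i)
  obtain ⟨δ₀, hδ₀, hlt⟩ := Metric.eventually_nhds_iff.1 hδ'
  refine ⟨∑ σ, ∑ i, C σ i + 1, by positivity, δ₀, hδ₀, fun t₀ ht₀ σ x₀ hx₀ hroot => ?_⟩
  have hev : ∀ᶠ p : EuclideanSpace ℝ ι × ℝ in 𝓝 (x₀, t₀), ∀ i, (Q σ i).evalEval p.2 (p.1 i) = 0 →
      |p.1 i - x₀ i| ≤ C σ i * t₀ ^ (1 / (D : ℝ) - 1) * |p.2 - t₀| := by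
    refine eventually_all.2 fun i => ?_
    have hti : t₀ ∈ Set.Ioo 0 (δ σ i) :=
      ⟨ht₀.1, hlt (by rw [Real.dist_eq, sub_zero, abs_of_pos ht₀.1]; exact ht₀.2) σ i⟩
    have hcont : Continuous fun p : EuclideanSpace ℝ ι × ℝ => (p.2, p.1 i) := by fun_prop
    exact (hcont.tendsto (x₀, t₀)).eventually (h σ i t₀ hti (x₀ i) (hx₀ i) (hroot i))
  filter_upwards [hev] with p hp hzero
  have hpow : 0 ≤ t₀ ^ (1 / (D : ℝ) - 1) := Real.rpow_nonneg ht₀.1.le _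
  calc ‖p.1 - x₀‖ ≤ ∑ i, |(p.1 - x₀) i| := EuclideanSpace.norm_le_sum_abs _
    _ ≤ ∑ i, C σ i * t₀ ^ (1 / (D : ℝ) - 1) * |p.2 - t₀| :=
        Finset.sum_le_sum fun i _ => by simpa using hp i (hzero i)
    _ = (∑ i, C σ i) * t₀ ^ (1 / (D : ℝ) - 1) * |p.2 - t₀| := by
        rw [Finset.sum_mul, Finset.sum_mul]
    _ ≤ _ := by
        gcongr
        exact (hM σ).trans (le_add_of_nonneg_right zero_le_one)

theorem IsCompact.exists_subseq_tendsto_and_eq {X κ : Type*} [TopologicalSpace X]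
    [FirstCountableTopology X] [Finite κ] {K : Set X} (hK : IsCompact K) {x : ℕ → X}
    (hx : ∀ k, x k ∈ K) (σ : ℕ → κ) :
    ∃ x₀ ∈ K, ∃ σ₀, ∃ φ : ℕ → ℕ, Tendsto φ atTop atTop ∧ Tendsto (x ∘ φ) atTop (𝓝 x₀) ∧
      ∀ k, σ (φ k) = σ₀ := by
  obtain ⟨x₀, hx₀, φ, hφ, hlim⟩ := hK.tendsto_subseq hx
  obtain ⟨σ₀, hσ₀⟩ := Finite.exists_infinite_fiber (fun k => σ (φ k))
  have hinf : {k | σ (φ k) = σ₀}.Infinite := Set.infinite_coe_iff.1 hσ₀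
  set ψ := Nat.nth (fun k => σ (φ k) = σ₀)
  have hψ : StrictMono ψ := Nat.nth_strictMono hinf
  exact ⟨x₀, hx₀, σ₀, φ ∘ ψ, hφ.tendsto_atTop.comp hψ.tendsto_atTop,
    hlim.comp hψ.tendsto_atTop, fun k => Nat.nth_mem_of_infinite hinf k⟩

end LevelSets

section Lojasiewicz

open MvPolynomial Filter Topology

/-- Gradient inequality near a zero `a` of `f`, on the set where `f` is positive, for a function
satisfying a polynomial equation of degree `d` and not locally constant off its zero set. -/
theorem MvPolynomial.exists_gradient_lower_bound_of_pos {n d : ℕ} (hd : 1 ≤ d)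
    {P : MvPolynomial (Fin (n + 1)) ℝ} (hP : P.totalDegree ≤ d)
    {U : Set (EuclideanSpace ℝ (Fin n))} (hU : IsOpen U)
    {f : EuclideanSpace ℝ (Fin n) → ℝ} (hf : DifferentiableOn ℝ f U)
    (hne : ∀ z ∈ U, f z ≠ 0 → ∃ᶠ y in 𝓝 z, f y ≠ f z)
    {a : EuclideanSpace ℝ (Fin n)} (ha : a ∈ U) (hfa : f a = 0)
    (hPf : ∀ x ∈ U, eval (Fin.snoc (fun i => x i) (f x) : Fin (n + 1) → ℝ) P = 0)
    (hPy : eval (Fin.snoc (fun i => a i) (f a) : Fin (n + 1) → ℝ) (pderiv (Fin.last n) P) ≠ 0) :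
    ∃ C > 0, ∃ ε > 0, ∀ z ∈ U, ‖z - a‖ < ε → 0 < f z → f z < ε →
      C * f z ^ (1 - 1 / (((2 * d) ^ n : ℕ) : ℝ)) ≤ ‖gradient f z‖ := by
  have hdiff : ∀ x ∈ U, DifferentiableAt ℝ f x := fun x hx =>
    (hf x hx).differentiableAt (hU.mem_nhds hx)
  obtain ⟨l, b, δ, hδ, K, hK, hmem, hbox⟩ :=
    exists_box_graph hU ha (hdiff a ha).continuousAt hfa hPf hPy
  obtain ⟨Q, hQ, hQmin⟩ := exists_minimizer_sqNormGrad hd P hP l b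
  obtain ⟨B, hB⟩ := (isCompact_Icc (a := l) (b := b)).isBounded.exists_norm_le
  obtain ⟨M, hM, δ', hδ', hdisp⟩ := Polynomial.exists_norm_displacement_bound B hQ
  obtain ⟨ρ, hρ, hρbox⟩ := Metric.eventually_nhds_iff.1 (eventually_eventually_nhds.2 hmem)
  refine ⟨(4 * M)⁻¹, by positivity, min ρ (min δ δ'), by positivity,
    fun z hzU hza hfz hfzlt => ?_⟩
  obtain ⟨hzρ, -⟩ := lt_min_iff.1 hza
  obtain ⟨-, hlt⟩ := lt_min_iff.1 hfzlt
  obtain ⟨htδ, htδ'⟩ := lt_min_iff.1 hlt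
  have hbz : ∀ᶠ y in 𝓝 z, y.ofLp ∈ Set.Icc l b := hρbox (by rwa [dist_eq_norm])
  have hfzc := (hdiff z hzU).continuousAt
  have htabs : |f z| < δ := by rwa [abs_of_pos hfz]
  have hfabs : ∀ᶠ y in 𝓝 z, |f y| < δ := hfzc.abs.eventually_lt_const htabs
  obtain ⟨y, hyz, hy⟩ := exists_seq_forall_of_frequently
    ((hne z hzU hfz.ne').and_eventually (hbz.and hfabs))
  -- minimizers of the horizontal gradient on the levels `f (y k)`
  choose σ x hxbox hxP hxmin hxQ using fun k =>
    hQmin (f (y k)) ⟨(y k).ofLp, (hy k).2.1, hPf _ (hbox _ (hy k).2.1).1⟩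
  obtain ⟨x₀, hx₀, σ₀, φ, hφ, hxlim, hσ⟩ := isCompact_Icc.exists_subseq_tendsto_and_eq hxbox σ
  have hylim : Tendsto (fun k => y (φ k)) atTop (𝓝 z) := hyz.comp hφ
  have htlim : Tendsto (fun k => f (y (φ k))) atTop (𝓝 (f z)) := hfzc.tendsto.comp hylim
  have hxtlim : Tendsto (fun k => (x (φ k), f (y (φ k)))) atTop (𝓝 (x₀, f z)) :=
    hxlim.prodMk_nhds htlim
  have hytlim : Tendsto (fun k => ((y (φ k)).ofLp, f (y (φ k)))) atTop (𝓝 (z.ofLp, f z)) :=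
    (((PiLp.continuous_ofLp 2 _).tendsto z).comp hylim).prodMk_nhds htlim
  have hP0 : eval (Fin.snoc x₀ (f z) : Fin (n + 1) → ℝ) P = 0 := by
    have h1 := (P.continuous_eval_snoc.tendsto (x₀, f z)).comp hxtlim
    exact tendsto_nhds_unique h1 (tendsto_const_nhds.congr fun k => (hxP (φ k)).symm)
  have hS : P.sqNormGrad x₀ (f z) ≤ P.sqNormGrad z.ofLp (f z) := by
    have h1 := (P.continuous_sqNormGrad.tendsto (x₀, f z)).comp hxtlim
    have h2 := (P.continuous_sqNormGrad.tendsto (z.ofLp, f z)).comp hytlim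
    exact le_of_tendsto_of_tendsto' h1 h2 fun k =>
      hxmin (φ k) _ (hy (φ k)).2.1 (hPf _ (hbox _ (hy (φ k)).2.1).1)
  have hQ0 : ∀ i, (Q σ₀ i).evalEval (f z) (x₀ i) = 0 := by
    intro i
    have hc : Continuous fun p : (Fin n → ℝ) × ℝ => (p.2, p.1 i) := by fun_prop
    have h1 := (((Q σ₀ i).continuous_evalEval.comp hc).tendsto (x₀, f z)).comp hxtlim
    refine tendsto_nhds_unique h1 (tendsto_const_nhds.congr fun k => ?_)
    have := hxQ (φ k) i
    rw [hσ k] at this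
    exact this.symm
  set X₀ : EuclideanSpace ℝ (Fin n) := WithLp.toLp 2 x₀ with hX₀
  set X : ℕ → EuclideanSpace ℝ (Fin n) := fun k => WithLp.toLp 2 (x (φ k)) with hX
  have hXlim : Tendsto X atTop (𝓝 X₀) := ((PiLp.continuous_toLp 2 _).tendsto x₀).comp hxlim
  have hX₀U : X₀ ∈ U := (hbox X₀ hx₀).1
  have hfX₀ : f X₀ = f z := ((hbox X₀ hx₀).2 (f z) htabs).1 hP0
  have hfX : ∀ k, f (X k) = f (y (φ k)) := fun k =>
    ((hbox (X k) (hxbox (φ k))).2 _ (hy (φ k)).2.2).1 (hxP (φ k))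
  have hev := (hXlim.prodMk_nhds htlim).eventually (hdisp (f z) ⟨hfz, htδ'⟩ σ₀ X₀
    (fun i => (norm_le_pi_norm x₀ i).trans (hB x₀ hx₀)) hQ0)
  set L := M * f z ^ (1 / (((2 * d) ^ n : ℕ) : ℝ) - 1) with hL
  have hL0 : 0 ≤ L := mul_nonneg hM.le (Real.rpow_nonneg hfz.le _)
  have h1 : 1 ≤ L * ‖gradient f X₀‖ := by
    refine one_le_mul_norm_gradient (hdiff X₀ hX₀U) hXlim hL0 ?_ fun k => ?_
    · filter_upwards [hev] with k hk
      rw [hfX, hfX₀]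
      refine hk fun i => ?_
      have := hxQ (φ k) i
      rwa [hσ k] at this
    · rw [hfX, hfX₀]
      exact (hy (φ k)).1
  have hPev : ∀ w ∈ U, ∀ᶠ v in 𝓝 w,
      eval (Fin.snoc (fun i => v i) (f v) : Fin (n + 1) → ℝ) P = 0 := fun w hw =>
    (show ∀ᶠ v in 𝓝 w, v ∈ U from hU.mem_nhds hw).mono hPf
  have hSX₀ := sqNormGrad_eq_of_eventually_eval_eq_zero (hdiff X₀ hX₀U) (hPev X₀ hX₀U)
  have hSz := sqNormGrad_eq_of_eventually_eval_eq_zero (hdiff z hzU) (hPev z hzU)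
  rw [hfX₀] at hSX₀
  have hle : ‖gradient f X₀‖ ≤ 4 * ‖gradient f z‖ := by
    have h2 := sq_le_sq.1 (hSX₀.symm.trans_le (hS.trans_eq hSz))
    rw [abs_mul, abs_mul, abs_norm, abs_norm] at h2
    have h3 := ((hbox X₀ hx₀).2 (f z) htabs).2.2.1
    have h4 := ((hbox z hbz.self_of_nhds).2 (f z) htabs).2.2.2
    refine le_of_mul_le_mul_left ?_ hK
    calc K * ‖gradient f X₀‖ ≤ _ := mul_le_mul_of_nonneg_right h3 (norm_nonneg _)
      _ ≤ _ := h2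
      _ ≤ 4 * K * ‖gradient f z‖ := mul_le_mul_of_nonneg_right h4 (norm_nonneg _)
      _ = _ := by ring
  have hpow : f z ^ (1 - 1 / (((2 * d) ^ n : ℕ) : ℝ)) *
      f z ^ (1 / (((2 * d) ^ n : ℕ) : ℝ) - 1) = 1 := by
    rw [← Real.rpow_add hfz]
    simp
  have hp0 : 0 ≤ f z ^ (1 - 1 / (((2 * d) ^ n : ℕ) : ℝ)) := Real.rpow_nonneg hfz.le _
  rw [inv_mul_le_iff₀ (by positivity)]
  calc f z ^ (1 - 1 / (((2 * d) ^ n : ℕ) : ℝ))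
      ≤ f z ^ (1 - 1 / (((2 * d) ^ n : ℕ) : ℝ)) * (L * ‖gradient f X₀‖) :=
        le_mul_of_one_le_right hp0 h1
    _ = M * ‖gradient f X₀‖ * (f z ^ (1 - 1 / (((2 * d) ^ n : ℕ) : ℝ)) *
          f z ^ (1 / (((2 * d) ^ n : ℕ) : ℝ) - 1)) := by rw [hL]; ring
    _ = M * ‖gradient f X₀‖ := by rw [hpow, mul_one]
    _ ≤ M * (4 * ‖gradient f z‖) := mul_le_mul_of_nonneg_left hle hM.le
    _ = 4 * M * ‖gradient f z‖ := by ring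

end Lojasiewicz

section Reflection

open MvPolynomial Filter Topology

theorem gradient_neg_apply {F : Type*} [NormedAddCommGroup F] [InnerProductSpace ℝ F]
    [CompleteSpace F] (f : F → ℝ) (x : F) : gradient (fun y => -f y) x = -gradient f x := by
  rw [gradient, gradient, fderiv_fun_neg, map_neg]

theorem MvPolynomial.exists_eval_snoc_neg {n : ℕ} (P : MvPolynomial (Fin (n + 1)) ℝ) :
    ∃ P' : MvPolynomial (Fin (n + 1)) ℝ, P'.totalDegree ≤ P.totalDegree ∧
      ∀ (x : Fin n → ℝ) (t : ℝ), eval (Fin.snoc x t : Fin (n + 1) → ℝ) P' =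
          eval (Fin.snoc x (-t) : Fin (n + 1) → ℝ) P ∧
        eval (Fin.snoc x t : Fin (n + 1) → ℝ) (pderiv (Fin.last n) P') =
          -eval (Fin.snoc x (-t) : Fin (n + 1) → ℝ) (pderiv (Fin.last n) P) := by
  set g : Fin (n + 1) → MvPolynomial (Fin (n + 1)) ℝ :=
    Fin.snoc (fun i => X i.castSucc) (-X (Fin.last n)) with hg
  have hg1 : ∀ i, (g i).totalDegree ≤ 1 := by
    intro i
    refine Fin.lastCases ?_ (fun j => ?_) i
    · simp [hg, totalDegree_X]
    · simp [hg, totalDegree_X]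
  have heval : ∀ (x : Fin n → ℝ) (t : ℝ), eval (Fin.snoc x t : Fin (n + 1) → ℝ) (aeval g P) =
      eval (Fin.snoc x (-t) : Fin (n + 1) → ℝ) P := by
    intro x t
    induction P using MvPolynomial.induction_on with
    | C a => simp
    | add p q hp hq => rw [map_add, map_add, map_add, hp, hq]
    | mul_X p i hp =>
      rw [map_mul, map_mul, map_mul, hp, aeval_X, eval_X]
      congr 1
      refine Fin.lastCases ?_ (fun j => ?_) i
      · simp [hg]
      · simp [hg]
  refine ⟨aeval g P, totalDegree_aeval_le g hg1 P, fun x t => ⟨heval x t, ?_⟩⟩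
  have h1 := (aeval g P).hasDerivAt_eval_snoc x t
  simp only [heval] at h1
  have h2 := (P.hasDerivAt_eval_snoc x (-t)).comp t (hasDerivAt_neg t)
  rw [h1.unique h2, mul_neg_one]

theorem MvPolynomial.exists_gradient_lower_bound {n d : ℕ} (hd : 1 ≤ d)
    {P : MvPolynomial (Fin (n + 1)) ℝ} (hP : P.totalDegree ≤ d)
    {U : Set (EuclideanSpace ℝ (Fin n))} (hU : IsOpen U)
    {f : EuclideanSpace ℝ (Fin n) → ℝ} (hf : DifferentiableOn ℝ f U)
    (hne : ∀ z ∈ U, f z ≠ 0 → ∃ᶠ y in 𝓝 z, f y ≠ f z)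
    {a : EuclideanSpace ℝ (Fin n)} (ha : a ∈ U) (hfa : f a = 0)
    (hPf : ∀ x ∈ U, eval (Fin.snoc (fun i => x i) (f x) : Fin (n + 1) → ℝ) P = 0)
    (hPy : eval (Fin.snoc (fun i => a i) (f a) : Fin (n + 1) → ℝ) (pderiv (Fin.last n) P) ≠ 0) :
    ∃ C > 0, ∃ ε > 0, ∀ z ∈ U, ‖z - a‖ < ε → f z ≠ 0 → |f z| < ε →
      C * |f z| ^ (1 - 1 / (((2 * d) ^ n : ℕ) : ℝ)) ≤ ‖gradient f z‖ := by
  obtain ⟨P', hP', hP'eval⟩ := P.exists_eval_snoc_neg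
  obtain ⟨C₁, hC₁, ε₁, hε₁, h₁⟩ :=
    exists_gradient_lower_bound_of_pos hd hP hU hf hne ha hfa hPf hPy
  obtain ⟨C₂, hC₂, ε₂, hε₂, h₂⟩ :=
    exists_gradient_lower_bound_of_pos hd (hP'.trans hP) hU (f := fun x => -f x) hf.neg
      (fun z hz hfz => (hne z hz (neg_ne_zero.1 hfz)).mono fun y hy h => hy (neg_injective h))
      ha (by rw [hfa, neg_zero])
      (fun x hx => by
        rw [(hP'eval _ _).1, neg_neg]
        exact hPf x hx)
      (by
        rw [(hP'eval _ _).2, neg_neg]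
        exact neg_ne_zero.2 hPy)
  refine ⟨min C₁ C₂, lt_min hC₁ hC₂, min ε₁ ε₂, lt_min hε₁ hε₂, fun z hz hza hfz hlt => ?_⟩
  rw [lt_min_iff] at hza hlt
  have hp : 0 ≤ |f z| ^ (1 - 1 / (((2 * d) ^ n : ℕ) : ℝ)) := Real.rpow_nonneg (abs_nonneg _) _
  rcases lt_or_gt_of_ne hfz with hneg | hpos
  · refine (mul_le_mul_of_nonneg_right (min_le_right _ _) hp).trans ?_
    rw [abs_of_neg hneg] at hlt ⊢
    have := h₂ z hz hza.2 (neg_pos.2 hneg) hlt.2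
    rwa [gradient_neg_apply, norm_neg] at this
  · refine (mul_le_mul_of_nonneg_right (min_le_left _ _) hp).trans ?_
    rw [abs_of_pos hpos] at hlt ⊢
    exact h₁ z hz hza.1 hpos hlt.1

theorem AnalyticOnNhd.frequently_ne_of_isPreconnected {E F : Type*} [NormedAddCommGroup E]
    [NormedSpace ℝ E] [NormedAddCommGroup F] [NormedSpace ℝ F] {U : Set E} {f : E → F}
    (hf : AnalyticOnNhd ℝ f U) (hU : IsPreconnected U) {a z : E} (ha : a ∈ U) (hz : z ∈ U)
    (hne : f z ≠ f a) : ∃ᶠ y in 𝓝 z, f y ≠ f z := fun h =>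
  hne (hf.eqOn_of_preconnected_of_eventuallyEq (g := fun _ => f z) analyticOnNhd_const hU hz
    (h.mono fun _ hy => not_not.1 hy) ha).symm

/-- If the zero set of a polynomial of degree at most one contains the graph of `f` and `f` has a
critical point, then `f` is constant. -/
theorem MvPolynomial.eqOn_const_of_totalDegree_le_one {n : ℕ} {P : MvPolynomial (Fin (n + 1)) ℝ}
    (hP : P.totalDegree ≤ 1) {U : Set (EuclideanSpace ℝ (Fin n))} (hU : IsOpen U)
    (hUc : IsPreconnected U) {f : EuclideanSpace ℝ (Fin n) → ℝ} (hf : DifferentiableOn ℝ f U)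
    {a : EuclideanSpace ℝ (Fin n)} (ha : a ∈ U) (hgrad : gradient f a = 0)
    (hPf : ∀ x ∈ U, eval (Fin.snoc (fun i => x i) (f x) : Fin (n + 1) → ℝ) P = 0)
    (hPy : ∀ x ∈ U,
      eval (Fin.snoc (fun i => x i) (f x) : Fin (n + 1) → ℝ) (pderiv (Fin.last n) P) ≠ 0)
    {x : EuclideanSpace ℝ (Fin n)} (hx : x ∈ U) : f x = f a := by
  have hdiff : ∀ x ∈ U, DifferentiableAt ℝ f x := fun x hx =>
    (hf x hx).differentiableAt (hU.mem_nhds hx)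
  have hconst : ∀ i (v w : Fin (n + 1) → ℝ), eval v (pderiv i P) = eval w (pderiv i P) := by
    intro i v w
    have h0 : (pderiv i P).totalDegree = 0 := by
      have := totalDegree_pderiv_le i P
      omega
    rw [totalDegree_eq_zero_iff_eq_C.1 h0, eval_C, eval_C]
  have hS : ∀ x ∈ U, P.sqNormGrad (fun i => x i) (f x) =
      (eval (Fin.snoc (fun i => x i) (f x) : Fin (n + 1) → ℝ) (pderiv (Fin.last n) P) *
        ‖gradient f x‖) ^ 2 := fun x hx =>
    sqNormGrad_eq_of_eventually_eval_eq_zero (hdiff x hx)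
      ((show ∀ᶠ v in 𝓝 x, v ∈ U from hU.mem_nhds hx).mono hPf)
  refine hU.is_const_of_fderiv_eq_zero hUc hf (fun w hw => ?_) hx ha
  have h1 : P.sqNormGrad (fun i => w i) (f w) = 0 := by
    rw [← show P.sqNormGrad (fun i => a i) (f a) = 0 by rw [hS a ha, hgrad]; simp]
    exact Finset.sum_congr rfl fun i _ => by rw [hconst]
  rw [hS w hw, sq_eq_zero_iff, mul_eq_zero, norm_eq_zero] at h1
  rw [← toDual_gradient, h1.resolve_left (hPy w hw), map_zero, Pi.zero_apply]

end Reflection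

theorem stmt_0 (n : ℕ) (U : Set (EuclideanSpace ℝ (Fin n))) (hUopen : IsOpen U)
    (hUconn : IsConnected U) (a : EuclideanSpace ℝ (Fin n)) (haU : a ∈ U)
    (f : EuclideanSpace ℝ (Fin n) → ℝ) (hf : AnalyticOnNhd ℝ f U)
    (hfne : ∃ x ∈ U, f x ≠ 0) (hfa : f a = 0) (hgrad : gradient f a = 0)
    (P : MvPolynomial (Fin (n + 1)) ℝ) (hPirr : Irreducible P)
    (hPf : ∀ x ∈ U, MvPolynomial.eval (Fin.snoc (fun i => x i) (f x)) P = 0)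
    (d : ℕ) (hd : d = P.totalDegree)
    (hPy : ∀ x ∈ U,
      MvPolynomial.eval (Fin.snoc (fun i => x i) (f x))
        (MvPolynomial.pderiv (Fin.last n) P) ≠ 0) :
    ∃ C > 0, ∃ ε > 0, ∀ x ∈ U, ‖x - a‖ < ε → |f x| < ε →
      ‖gradient f x‖ ≥ C * |f x| ^
        (1 - 1 / ((max (2 * d * (2 * d - 1)) (d * (3 * d - 2) ^ n) + 1 : ℕ) : ℝ)) := by
  have hdiff : DifferentiableOn ℝ f U := hf.differentiableOn
  have hd2 : 2 ≤ d := by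
    by_contra! hlt
    obtain ⟨x, hx, hfx⟩ := hfne
    refine hfx (hfa ▸ MvPolynomial.eqOn_const_of_totalDegree_le_one (by omega) hUopen
      hUconn.isPreconnected hdiff haU hgrad hPf hPy hx)
  obtain ⟨C, hC, ε, hε, h⟩ := MvPolynomial.exists_gradient_lower_bound (by omega : 1 ≤ d) hd.ge
    hUopen hdiff
    (fun z hz hfz => hf.frequently_ne_of_isPreconnected hUconn.isPreconnected haU hz
      (by rwa [hfa])) haU hfa hPf (hPy a haU)
  refine ⟨C, hC, min ε 1, lt_min hε one_pos, fun x hx hxa hfx => ?_⟩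
  rw [lt_min_iff] at hxa hfx
  set R := max (2 * d * (2 * d - 1)) (d * (3 * d - 2) ^ n) + 1 with hR
  have hDR : (2 * d) ^ n ≤ R := by
    have h1 : (2 * d) ^ n ≤ d * (3 * d - 2) ^ n :=
      (Nat.pow_le_pow_left (by omega) n).trans (Nat.le_mul_of_pos_left _ (by omega))
    omega
  have hR1 : 1 < R := by
    have h1 : 0 < 2 * d * (2 * d - 1) := Nat.mul_pos (by omega) (by omega)
    omega
  have hD0 : (0 : ℝ) < ((2 * d) ^ n : ℕ) := by positivity
  rcases eq_or_ne (f x) 0 with h0 | h0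
  · have hexp : (1 : ℝ) - 1 / (R : ℝ) ≠ 0 := by
      have : (1 : ℝ) < R := by exact_mod_cast hR1
      have := (div_lt_one (by linarith : (0 : ℝ) < R)).2 this
      linarith
    rw [h0, abs_zero, Real.zero_rpow hexp, mul_zero]
    exact norm_nonneg _
  · refine (mul_le_mul_of_nonneg_left ?_ hC.le).trans (h x hx hxa.1 h0 hfx.1)
    refine Real.rpow_le_rpow_of_exponent_ge (abs_pos.2 h0) hfx.2.le ?_
    have : 1 / (R : ℝ) ≤ 1 / (((2 * d) ^ n : ℕ) : ℝ) :=
      one_div_le_one_div_of_le hD0 (by exact_mod_cast hDR)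
    linarith
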